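/- arXiv:2305.05437 — 4 statements merged into one kernel-verified Lean document; each statement's English description precedes it below -/
import Mathlib

section
/- Let u_ε be a classical solution of the regularized anisotropic problem with ε ∈ (0,ε₀], satisfying |u_ε| ≤ M on Q̄_T, and suppose F satisfies the monotonicity condition F(x,u,z) ≤ F(x,v,z) whenever u ≥ v. Then for every ε ∈ (0,ε₀] and all (t,x) ∈ Q̄_T one has |u_ε(t,x) − u₀(x)| ≤ K t, where K is the constant defined in the context (assumed finite). -/
open Set Filter MeasureTheory Metric

noncomputable section

/-- The `i`-th partial derivative of a function on Euclidean space. -/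
def pd {n : ℕ} (f : EuclideanSpace ℝ (Fin n) → ℝ) (i : Fin n)
    (x : EuclideanSpace ℝ (Fin n)) : ℝ :=
  fderiv ℝ f x (EuclideanSpace.single i 1)

/-- The gradient vector of a function on Euclidean space. -/
def gradv {n : ℕ} (f : EuclideanSpace ℝ (Fin n) → ℝ)
    (x : EuclideanSpace ℝ (Fin n)) : EuclideanSpace ℝ (Fin n) :=
  (WithLp.equiv 2 (Fin n → ℝ)).symm (fun i => pd f i x)

/-- The exterior sphere condition for a domain. -/
def ExteriorSphereCond {n : ℕ} (Ω : Set (EuclideanSpace ℝ (Fin n))) : Prop :=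
  ∀ y ∈ frontier Ω, ∃ z r, 0 < r ∧ closedBall z r ∩ closure Ω = {y}

/-- `f` is of class `C^{1+γ}` on `s` (C¹ with γ-Hölder continuous derivative). -/
def C1HolderOn {n : ℕ} (γ : ℝ) (s : Set (EuclideanSpace ℝ (Fin n)))
    (f : EuclideanSpace ℝ (Fin n) → ℝ) : Prop :=
  ContDiffOn ℝ 1 f s ∧
    ∃ C : NNReal, HolderOnWith C γ.toNNReal (fun x => fderivWithin ℝ f s x) s

/-- Classical solution of the regularized anisotropic problem
`u_t = ∑ᵢ ((u_{xᵢ}² + ε)^{pᵢ(x)/2} u_{xᵢ})_{xᵢ} + F(x, u, ∇u)` in `Q_T = (0,T) × Ω`,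
with `u = ψ` on `∂Ω × (0,T)` and `u(0,·) = u₀` in `Ω`. -/
structure IsClassicalSolAniso {n : ℕ} (Ω : Set (EuclideanSpace ℝ (Fin n))) (T : ℝ)
    (p : Fin n → EuclideanSpace ℝ (Fin n) → ℝ)
    (F : EuclideanSpace ℝ (Fin n) → ℝ → EuclideanSpace ℝ (Fin n) → ℝ)
    (ψ u₀ : EuclideanSpace ℝ (Fin n) → ℝ) (ε : ℝ)
    (u : ℝ → EuclideanSpace ℝ (Fin n) → ℝ) : Prop where
  cont : ContinuousOn (fun q : ℝ × EuclideanSpace ℝ (Fin n) => u q.1 q.2)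
      (Icc 0 T ×ˢ closure Ω)
  diff_t : ∀ t ∈ Ioo 0 T, ∀ x ∈ Ω, DifferentiableAt ℝ (fun s => u s x) t
  smooth_x : ∀ t ∈ Ioo 0 T, ∀ x ∈ Ω, ContDiffAt ℝ 2 (u t) x
  cont_ut : ContinuousOn
      (fun q : ℝ × EuclideanSpace ℝ (Fin n) => deriv (fun s => u s q.2) q.1) (Ioo 0 T ×ˢ Ω)
  cont_ux : ∀ i, ContinuousOn
      (fun q : ℝ × EuclideanSpace ℝ (Fin n) => pd (u q.1) i q.2) (Ioo 0 T ×ˢ Ω)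
  cont_uxx : ∀ i j, ContinuousOn
      (fun q : ℝ × EuclideanSpace ℝ (Fin n) => pd (fun y => pd (u q.1) j y) i q.2)
      (Ioo 0 T ×ˢ Ω)
  eqn : ∀ t ∈ Ioo 0 T, ∀ x ∈ Ω,
      deriv (fun s => u s x) t =
        (∑ i, pd (fun y => ((pd (u t) i y) ^ 2 + ε) ^ (p i y / 2) * pd (u t) i y) i x)
          + F x (u t x) (gradv (u t) x)
  bdry : ∀ t ∈ Ioo 0 T, ∀ x ∈ frontier Ω, u t x = ψ x
  init : ∀ x ∈ closure Ω, u 0 x = u₀ x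

/-- The second derivative test: a nondegenerate minimum is not a local maximum. -/
theorem IsLocalMax.deriv_deriv_nonpos {f : ℝ → ℝ} {a : ℝ} (h : IsLocalMax f a)
    (hf : ContinuousAt f a) : deriv (deriv f) a ≤ 0 := by
  by_contra! hpos
  have hmin : IsLocalMin f a := isLocalMin_of_deriv_deriv_pos hpos h.deriv_eq_zero hf
  have hconst : f =ᶠ[nhds a] fun _ => f a := by
    filter_upwards [h, hmin] with y h₁ h₂ using le_antisymm h₁ h₂
  have hzero := hconst.deriv.deriv_eq
  simp at hzero
  exact hpos.ne' hzero

section Partial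

variable {n : ℕ} {f g : EuclideanSpace ℝ (Fin n) → ℝ} {x : EuclideanSpace ℝ (Fin n)}

theorem DifferentiableAt.deriv_line_eq_pd {i : Fin n} {τ : ℝ}
    (hf : DifferentiableAt ℝ f (x + τ • EuclideanSpace.single i 1)) :
    deriv (fun s : ℝ => f (x + s • EuclideanSpace.single i 1)) τ
      = pd f i (x + τ • EuclideanSpace.single i 1) := by
  have hl : HasDerivAt (fun s : ℝ => x + s • EuclideanSpace.single i (1 : ℝ))
      (EuclideanSpace.single i (1 : ℝ)) τ := by
    simpa using ((hasDerivAt_id τ).smul_const (EuclideanSpace.single i (1 : ℝ))).const_add x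
  exact (hf.hasFDerivAt.comp_hasDerivAt τ hl).deriv

theorem ContDiffAt.differentiableAt_pd (hf : ContDiffAt ℝ 2 f x) (i : Fin n) :
    DifferentiableAt ℝ (pd f i) x := by
  have h : ContDiffAt ℝ 1 (fderiv ℝ f) x := hf.fderiv_right (by norm_num)
  exact (h.differentiableAt one_ne_zero).clm_apply (differentiableAt_const _)

theorem pd_sub (hf : DifferentiableAt ℝ f x) (hg : DifferentiableAt ℝ g x) (i : Fin n) :
    pd (fun y => f y - g y) i x = pd f i x - pd g i x := by
  simp [pd, fderiv_fun_sub hf hg]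

theorem ContDiffAt.eventually_differentiableAt (hf : ContDiffAt ℝ 2 f x) :
    ∀ᶠ y in nhds x, DifferentiableAt ℝ f y := by
  filter_upwards [hf.eventually (by simp)] with y hy using hy.differentiableAt two_ne_zero

theorem IsLocalMax.pd_pd_nonpos (h : IsLocalMax f x) (hf : ContDiffAt ℝ 2 f x) (i : Fin n) :
    pd (pd f i) i x ≤ 0 := by
  set l : ℝ → EuclideanSpace ℝ (Fin n) := fun s => x + s • EuclideanSpace.single i (1 : ℝ) with hl
  have hlc : Continuous l := by fun_prop
  have hl0 : l 0 = x := by simp [hl]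
  have hlt : Tendsto l (nhds 0) (nhds x) := by simpa [hl0] using hlc.tendsto 0
  have hmax : IsLocalMax (fun s => f (l s)) 0 := by
    have := hlt.eventually h
    simpa [IsLocalMax, IsMaxFilter, hl0] using this
  have hcont : ContinuousAt (fun s => f (l s)) 0 :=
    ContinuousAt.comp (by simpa [hl0] using hf.continuousAt) hlc.continuousAt
  have hd : deriv (fun s => f (l s)) =ᶠ[nhds 0] fun s => pd f i (l s) := by
    filter_upwards [hlt.eventually hf.eventually_differentiableAt] with s hs
      using hs.deriv_line_eq_pd
  have hdd : deriv (fun s => pd f i (l s)) 0 = pd (pd f i) i (l 0) :=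
    DifferentiableAt.deriv_line_eq_pd (by simpa using hf.differentiableAt_pd i)
  have := hmax.deriv_deriv_nonpos hcont
  rwa [hd.deriv_eq, hdd, hl0] at this

theorem IsLocalMax.pd_eq (h : IsLocalMax (fun y => f y - g y) x) (hf : ContDiffAt ℝ 2 f x)
    (hg : ContDiffAt ℝ 2 g x) (i : Fin n) : pd f i x = pd g i x := by
  have h0 : pd (fun y => f y - g y) i x = 0 := by simp [pd, h.fderiv_eq_zero]
  rw [pd_sub (hf.differentiableAt two_ne_zero) (hg.differentiableAt two_ne_zero)] at h0
  linarith

theorem IsLocalMax.pd_pd_le (h : IsLocalMax (fun y => f y - g y) x) (hf : ContDiffAt ℝ 2 f x)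
    (hg : ContDiffAt ℝ 2 g x) (i : Fin n) : pd (pd f i) i x ≤ pd (pd g i) i x := by
  have hle := h.pd_pd_nonpos (hf.sub hg) i
  have heq : pd (fun y => f y - g y) i =ᶠ[nhds x] fun y => pd f i y - pd g i y := by
    filter_upwards [hf.eventually_differentiableAt, hg.eventually_differentiableAt] with y h₁ h₂
      using pd_sub h₁ h₂ i
  rw [pd, heq.fderiv_eq, ← pd, pd_sub (hf.differentiableAt_pd i) (hg.differentiableAt_pd i)] at hle
  linarith

/-- The derivative of the flux `(s² + ε)^(q/2) s`, in a form that is affine in the derivative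
of `s`. -/
theorem pd_flux {s q : EuclideanSpace ℝ (Fin n) → ℝ} {ε : ℝ} (hε : 0 < ε)
    (hs : DifferentiableAt ℝ s x) (hq : DifferentiableAt ℝ q x) (i : Fin n) :
    pd (fun y => (s y ^ 2 + ε) ^ (q y / 2) * s y) i x
      = (s x ^ 2 + ε) ^ (q x / 2) * Real.log (s x ^ 2 + ε) * (pd q i x / 2) * s x
        + (s x ^ 2 + ε) ^ (q x / 2 - 1) * (s x ^ 2 * (1 + q x) + ε) * pd s i x := by
  have hpos : 0 < s x ^ 2 + ε := by positivity
  have h := (((hs.hasFDerivAt.pow 2).add_const ε).rpow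
    (hq.hasFDerivAt.mul_const (2 : ℝ)⁻¹) hpos).mul hs.hasFDerivAt
  simp only [← div_eq_mul_inv] at h
  have hr : (s x ^ 2 + ε) ^ (q x / 2) = (s x ^ 2 + ε) ^ (q x / 2 - 1) * (s x ^ 2 + ε) := by
    rw [← Real.rpow_add_one hpos.ne', sub_add_cancel]
  change fderiv ℝ ((fun y => (s y ^ 2 + ε) ^ (q y / 2)) * s) x _ = _
  rw [h.fderiv]
  simp [pd]
  rw [hr]
  ring

theorem IsLocalMax.pd_flux_le (h : IsLocalMax (fun y => f y - g y) x) (hf : ContDiffAt ℝ 2 f x)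
    (hg : ContDiffAt ℝ 2 g x) {q : EuclideanSpace ℝ (Fin n) → ℝ} {ε : ℝ} (hε : 0 < ε)
    (hq : DifferentiableAt ℝ q x) (hq1 : -1 < q x) (i : Fin n) :
    pd (fun y => (pd f i y ^ 2 + ε) ^ (q y / 2) * pd f i y) i x
      ≤ pd (fun y => (pd g i y ^ 2 + ε) ^ (q y / 2) * pd g i y) i x := by
  rw [pd_flux hε (hf.differentiableAt_pd i) hq, pd_flux hε (hg.differentiableAt_pd i) hq,
    h.pd_eq hf hg i]
  have : 0 ≤ 1 + q x := by linarith
  gcongr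
  exact h.pd_pd_le hf hg i

end Partial

/-- A weak maximum principle for functions with controlled growth at spatial maxima. -/
theorem le_mul_of_deriv_le_at_isLocalMax {n : ℕ} {Ω : Set (EuclideanSpace ℝ (Fin n))}
    (hΩo : IsOpen Ω) (hΩbd : Bornology.IsBounded Ω) {T K : ℝ} (hK : 0 ≤ K)
    {w : ℝ → EuclideanSpace ℝ (Fin n) → ℝ}
    (hw : ContinuousOn (fun q : ℝ × EuclideanSpace ℝ (Fin n) => w q.1 q.2)
      (Icc 0 T ×ˢ closure Ω))
    (hdiff : ∀ t ∈ Ioo 0 T, ∀ x ∈ Ω, DifferentiableAt ℝ (fun s => w s x) t)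
    (hinit : ∀ x ∈ closure Ω, w 0 x ≤ 0)
    (hbdry : ∀ t ∈ Ioo 0 T, ∀ x ∈ frontier Ω, w t x ≤ 0)
    (hmax : ∀ t ∈ Ioo 0 T, ∀ x ∈ Ω, IsLocalMax (w t) x → deriv (fun s => w s x) t ≤ K) :
    ∀ t ∈ Icc 0 T, ∀ x ∈ closure Ω, w t x ≤ K * t := by
  have strict : ∀ δ > 0, ∀ t ∈ Ico 0 T, ∀ x ∈ closure Ω, w t x ≤ (K + δ) * t := by
    intro δ hδ T' hT' x hx
    have hsub : Icc 0 T' ×ˢ closure Ω ⊆ Icc 0 T ×ˢ closure Ω :=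
      prod_mono (Icc_subset_Icc_right hT'.2.le) subset_rfl
    obtain ⟨⟨t₁, x₁⟩, ⟨ht₁, hx₁⟩, hm⟩ :=
      (isCompact_Icc.prod hΩbd.isCompact_closure).exists_isMaxOn
        (f := fun q : ℝ × EuclideanSpace ℝ (Fin n) => w q.1 q.2 - (K + δ) * q.1)
        ⟨(T', x), ⟨right_mem_Icc.2 hT'.1, hx⟩⟩ ((hw.mono hsub).sub (by fun_prop))
    have hm' : ∀ s ∈ Icc 0 T', ∀ y ∈ closure Ω,
        w s y - (K + δ) * s ≤ w t₁ x₁ - (K + δ) * t₁ := fun s hs y hy =>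
      hm (show (s, y) ∈ Icc 0 T' ×ˢ closure Ω from ⟨hs, hy⟩)
    suffices hle : w t₁ x₁ - (K + δ) * t₁ ≤ 0 by
      linarith [hm' T' (right_mem_Icc.2 hT'.1) x hx]
    simp only at ht₁ hx₁
    rcases ht₁.1.eq_or_lt with h0 | h0
    · subst h0
      simpa using hinit x₁ hx₁
    have htT : t₁ ∈ Ioo 0 T := ⟨h0, ht₁.2.trans_lt hT'.2⟩
    by_cases hxΩ : x₁ ∈ Ω
    · exfalso
      have hloc : IsLocalMax (w t₁) x₁ := by
        filter_upwards [hΩo.mem_nhds hxΩ] with y hy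
        linarith [hm' t₁ ht₁ y (subset_closure hy)]
      have hd := hmax t₁ htT x₁ hxΩ hloc
      have hD := (hdiff t₁ htT x₁ hxΩ).hasDerivAt.tendsto_slope
      have hD' := hD.mono_left (nhdsWithin_mono t₁ (s := Iio t₁) fun s hs => ne_of_lt hs)
      have hge : K + δ ≤ deriv (fun s => w s x₁) t₁ := by
        refine ge_of_tendsto hD' ?_
        filter_upwards [Ioo_mem_nhdsLT h0] with s hs
        rw [slope_comm, slope_def_field, le_div_iff₀ (by linarith [hs.2])]
        linarith [hm' s ⟨hs.1.le, hs.2.le.trans ht₁.2⟩ x₁ hx₁]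
      linarith
    · have hfr : x₁ ∈ frontier Ω := ⟨hx₁, by rwa [hΩo.interior_eq]⟩
      have := hbdry t₁ htT x₁ hfr
      have : 0 ≤ (K + δ) * t₁ := by positivity
      linarith
  have hlt : ∀ t ∈ Ico 0 T, ∀ x ∈ closure Ω, w t x ≤ K * t := by
    intro t ht x hx
    have hlim : Tendsto (fun δ : ℝ => (K + δ) * t) (nhdsWithin 0 (Ioi 0)) (nhds (K * t)) := by
      have : Continuous fun δ : ℝ => (K + δ) * t := by fun_prop
      simpa using (this.tendsto 0).mono_left nhdsWithin_le_nhds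
    refine ge_of_tendsto hlim ?_
    filter_upwards [self_mem_nhdsWithin] with δ hδ using strict δ hδ t ht x hx
  intro t ht x hx
  rcases ht.2.eq_or_lt with rfl | h
  · rcases ht.1.eq_or_lt with h0 | h0
    · subst h0
      simpa using hinit x hx
    have hc : ContinuousOn (fun s => w s x) (Icc 0 t) :=
      hw.comp (f := fun s => (s, x)) (by fun_prop) fun s hs => ⟨hs, hx⟩
    have hmem : t ∈ closure (Ico 0 t) := by
      rw [closure_Ico h0.ne]
      exact ht
    refine ContinuousWithinAt.closure_le hmem ((hc t ht).mono Ico_subset_Icc_self)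
      (by fun_prop) fun s hs => hlt s hs x hx
  · exact hlt t ⟨ht.1, h⟩ x hx

theorem stmt1
    (n : ℕ) (hn : 0 < n)
    (Ω : Set (EuclideanSpace ℝ (Fin n)))
    (hΩo : IsOpen Ω) (hΩconn : IsConnected Ω)
    (hΩbd : Bornology.IsBounded Ω) (hΩsph : ExteriorSphereCond Ω)
    (T : ℝ) (hT : 0 < T)
    (γ : ℝ) (hγ : γ ∈ Ioo (0:ℝ) 1)
    (p : Fin n → EuclideanSpace ℝ (Fin n) → ℝ)
    (hp : ∀ i, C1HolderOn γ (closure Ω) (p i))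
    (hp1 : ∀ i, ∀ x ∈ closure Ω, -1 < p i x)
    (ε₀ : ℝ) (hε₀ : 0 < ε₀)
    (F : EuclideanSpace ℝ (Fin n) → ℝ → EuclideanSpace ℝ (Fin n) → ℝ)
    (hF : ContinuousOn
      (fun q : EuclideanSpace ℝ (Fin n) × ℝ × EuclideanSpace ℝ (Fin n) => F q.1 q.2.1 q.2.2)
      (closure Ω ×ˢ (univ : Set (ℝ × EuclideanSpace ℝ (Fin n)))))
    (hFmono : ∀ x ∈ closure Ω, ∀ v w : ℝ, ∀ z : EuclideanSpace ℝ (Fin n),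
      w ≤ v → F x v z ≤ F x w z)
    (ψ u₀ : EuclideanSpace ℝ (Fin n) → ℝ)
    (U : Set (EuclideanSpace ℝ (Fin n))) (hU : IsOpen U) (hUΩ : closure Ω ⊆ U)
    (hu₀ : ContDiffOn ℝ 2 u₀ U)
    (hu₀ψ : ∀ x ∈ frontier Ω, u₀ x = ψ x)
    (M : ℝ) (hM : 0 < M)
    (ε : ℝ) (hε : ε ∈ Ioc (0:ℝ) ε₀)
    (u : ℝ → EuclideanSpace ℝ (Fin n) → ℝ)
    (hu : IsClassicalSolAniso Ω T p F ψ u₀ ε u)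
    (hub : ∀ t ∈ Icc 0 T, ∀ x ∈ closure Ω, |u t x| ≤ M)
    (A B K : ℝ)
    (hA : IsLUB {a : ℝ | ∃ ε' ∈ Icc (0:ℝ) ε₀, ∃ x ∈ closure Ω,
      a = |∑ i, pd (fun y => ((pd u₀ i y) ^ 2 + ε') ^ (p i y / 2) * pd u₀ i y) i x|} A)
    (hB : IsLUB {a : ℝ | ∃ x ∈ closure Ω, ∃ v ∈ Icc (-M) M,
      a = |F x v (gradv u₀ x)|} B)
    (hK : K = A + B)
    :
    ∀ t ∈ Icc 0 T, ∀ x ∈ closure Ω, |u t x - u₀ x| ≤ K * t := by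
  obtain ⟨x₀, hx₀⟩ := hΩconn.nonempty
  have hK0 : 0 ≤ K := by
    rw [hK]
    exact add_nonneg
      ((abs_nonneg _).trans (hA.1 ⟨0, ⟨le_rfl, hε₀.le⟩, x₀, subset_closure hx₀, rfl⟩))
      ((abs_nonneg _).trans (hB.1 ⟨x₀, subset_closure hx₀, 0, ⟨by linarith, hM.le⟩, rfl⟩))
  have hu₀c : ContinuousOn (fun q : ℝ × EuclideanSpace ℝ (Fin n) => u₀ q.2)
      (Icc 0 T ×ˢ closure Ω) :=
    (hu₀.continuousOn.mono hUΩ).comp continuousOn_snd fun q hq => hq.2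
  have hu₀x : ∀ x ∈ Ω, ContDiffAt ℝ 2 u₀ x := fun x hx =>
    hu₀.contDiffAt (hU.mem_nhds (hUΩ (subset_closure hx)))
  have hpx : ∀ i, ∀ x ∈ Ω, DifferentiableAt ℝ (p i) x := fun i x hx =>
    ((hp i).1.contDiffAt (mem_of_superset (hΩo.mem_nhds hx) subset_closure)).differentiableAt
      one_ne_zero
  have hSA : ∀ x ∈ Ω,
      |∑ i, pd (fun y => ((pd u₀ i y) ^ 2 + ε) ^ (p i y / 2) * pd u₀ i y) i x| ≤ A :=
    fun x hx => hA.1 ⟨ε, ⟨hε.1.le, hε.2⟩, x, subset_closure hx, rfl⟩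
  have hFB : ∀ t ∈ Ioo 0 T, ∀ x ∈ Ω, |F x (u t x) (gradv u₀ x)| ≤ B := fun t ht x hx =>
    hB.1 ⟨x, subset_closure hx, u t x,
      abs_le.1 (hub t (Ioo_subset_Icc_self ht) x (subset_closure hx)), rfl⟩
  have upper : ∀ t ∈ Icc 0 T, ∀ x ∈ closure Ω, u t x - u₀ x ≤ K * t := by
    refine le_mul_of_deriv_le_at_isLocalMax (w := fun t x => u t x - u₀ x) hΩo hΩbd hK0
      (hu.cont.sub hu₀c) (fun t ht x hx => (hu.diff_t t ht x hx).sub_const _)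
      (fun x hx => by simp [hu.init x hx])
      (fun t ht x hx => by simp [hu.bdry t ht x hx, hu₀ψ x hx]) ?_
    intro t ht x hx hloc
    have hgrad : gradv (u t) x = gradv u₀ x := by
      simp only [gradv, hloc.pd_eq (hu.smooth_x t ht x hx) (hu₀x x hx)]
    have hsum := Finset.sum_le_sum fun i (_ : i ∈ Finset.univ) =>
      hloc.pd_flux_le (hu.smooth_x t ht x hx) (hu₀x x hx) hε.1 (hpx i x hx)
        (hp1 i x (subset_closure hx)) i
    rw [deriv_sub_const, hu.eqn t ht x hx, hgrad, hK]
    linarith [(abs_le.1 (hSA x hx)).2, (abs_le.1 (hFB t ht x hx)).2]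
  have lower : ∀ t ∈ Icc 0 T, ∀ x ∈ closure Ω, u₀ x - u t x ≤ K * t := by
    refine le_mul_of_deriv_le_at_isLocalMax (w := fun t x => u₀ x - u t x) hΩo hΩbd hK0
      (hu₀c.sub hu.cont) (fun t ht x hx => (hu.diff_t t ht x hx).const_sub _)
      (fun x hx => by simp [hu.init x hx])
      (fun t ht x hx => by simp [hu.bdry t ht x hx, hu₀ψ x hx]) ?_
    intro t ht x hx hloc
    have hgrad : gradv (u t) x = gradv u₀ x := by
      simp only [gradv, hloc.pd_eq (hu₀x x hx) (hu.smooth_x t ht x hx)]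
    have hsum := Finset.sum_le_sum fun i (_ : i ∈ Finset.univ) =>
      hloc.pd_flux_le (hu₀x x hx) (hu.smooth_x t ht x hx) hε.1 (hpx i x hx)
        (hp1 i x (subset_closure hx)) i
    rw [deriv_const_sub, hu.eqn t ht x hx, hgrad, hK]
    linarith [(abs_le.1 (hSA x hx)).1, (abs_le.1 (hFB t ht x hx)).1]
  exact fun t ht x hx => abs_sub_le_iff.2 ⟨upper t ht x hx, lower t ht x hx⟩
end
end

section
/- Let u_ε be a classical solution of the regularized anisotropic problem with ε ∈ (0,ε₀], satisfying |u_ε| ≤ M on Q̄_T, and suppose F satisfies the monotonicity condition F(x,u,z) ≤ F(x,v,z) whenever u ≥ v. Then in the closed prism P̄ = {(t,τ,x) : t ∈ [0,T], τ ∈ [0,T], x ∈ Ω̄, t ≥ τ} one has u_ε(τ,x) − u_ε(t,x) ≤ K(t−τ), where K is the constant defined in the context. -/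
open Set Filter MeasureTheory Metric

noncomputable section

lemma ContDiffAt.fderiv_apply_const {E : Type*} [NormedAddCommGroup E] [NormedSpace ℝ E]
    {f : E → ℝ} {x : E} (hf : ContDiffAt ℝ 2 f x) (e : E) :
    DifferentiableAt ℝ (fun y => fderiv ℝ f y e) x := by
  have h : ContDiffAt ℝ 1 (fderiv ℝ f) x := hf.fderiv_right (by norm_num)
  exact (h.differentiableAt (by norm_num)).clm_apply (differentiableAt_const e)

/-- Second-order necessary condition for a local maximum. -/
lemma IsLocalMax.fderiv_fderiv_nonpos {E : Type*} [NormedAddCommGroup E] [NormedSpace ℝ E]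
    {f : E → ℝ} {x : E} (hm : IsLocalMax f x) (hf : ContDiffAt ℝ 2 f x) (e : E) :
    fderiv ℝ (fun y => fderiv ℝ f y e) x e ≤ 0 := by
  by_contra! hpos
  have hline : ∀ s : ℝ, HasDerivAt (fun s : ℝ => x + s • e) e s := fun s => by
    simpa using ((hasDerivAt_id s).smul_const e).const_add x
  have hcont : Tendsto (fun s : ℝ => x + s • e) (nhds 0) (nhds x) := by
    simpa [ContinuousAt] using (hline 0).continuousAt
  set g : ℝ → ℝ := fun s => f (x + s • e) with hg
  have hev : ∀ᶠ y in nhds x, DifferentiableAt ℝ f y :=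
    (hf.eventually (by simp)).mono fun y hy => hy.differentiableAt (by norm_num)
  have hg1 : deriv g =ᶠ[nhds 0] fun s => fderiv ℝ f (x + s • e) e := by
    filter_upwards [hcont.eventually hev] with s hs
    exact (hs.hasFDerivAt.comp_hasDerivAt s (hline s)).deriv
  have hg2 : deriv (deriv g) 0 = fderiv ℝ (fun y => fderiv ℝ f y e) x e := by
    rw [hg1.deriv_eq]
    have h1 : HasFDerivAt (fun y => fderiv ℝ f y e)
        (fderiv ℝ (fun y => fderiv ℝ f y e) x) (x + (0 : ℝ) • e) := by
      simpa using (hf.fderiv_apply_const e).hasFDerivAt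
    exact (h1.comp_hasDerivAt (0 : ℝ) (hline 0)).deriv
  have hmax : IsLocalMax g 0 := by
    filter_upwards [hcont.eventually hm] with s hs
    simpa [hg] using hs
  have hgc : ContinuousAt g 0 := by
    have : ContinuousAt f (x + (0 : ℝ) • e) := by simpa using hf.continuousAt
    exact ContinuousAt.comp (f := fun s : ℝ => x + s • e) this (hline 0).continuousAt
  have hmin : IsLocalMin g 0 :=
    isLocalMin_of_deriv_deriv_pos (hg2 ▸ hpos) hmax.deriv_eq_zero hgc
  have hconst : g =ᶠ[nhds 0] fun _ => g 0 := by
    filter_upwards [hmax, hmin] with s h1 h2 using le_antisymm h1 h2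
  have h0 : deriv (deriv g) 0 = 0 := by
    rw [hconst.deriv.deriv_eq]; simp
  linarith

/-- The derivative of the regularized flux `(φ² + ε)^(q/2) φ` in the direction `e`. -/
lemma fderiv_flux_apply {E : Type*} [NormedAddCommGroup E] [NormedSpace ℝ E]
    {φ q : E → ℝ} {x : E} {ε : ℝ} (hε : 0 < ε) (hφ : DifferentiableAt ℝ φ x)
    (hq : DifferentiableAt ℝ q x) (e : E) :
    fderiv ℝ (fun y => (φ y ^ 2 + ε) ^ (q y / 2) * φ y) x e =
      (φ x ^ 2 + ε) ^ (q x / 2 - 1) * ((1 + q x) * φ x ^ 2 + ε) * fderiv ℝ φ x e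
      + (φ x ^ 2 + ε) ^ (q x / 2) * Real.log (φ x ^ 2 + ε) * φ x / 2 * fderiv ℝ q x e := by
  have hb : 0 < φ x ^ 2 + ε := by positivity
  have h := (((hφ.hasFDerivAt.pow 2).add_const ε).rpow (hq.hasFDerivAt.mul_const (2⁻¹ : ℝ))
    hb).mul hφ.hasFDerivAt
  have h' : fderiv ℝ (fun y => (φ y ^ 2 + ε) ^ (q y / 2) * φ y) x = _ := h.fderiv
  rw [h']
  have hr : (φ x ^ 2 + ε) ^ (q x / 2) = (φ x ^ 2 + ε) ^ (q x / 2 - 1) * (φ x ^ 2 + ε) := by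
    rw [Real.rpow_sub_one hb.ne']; field_simp
  simp only [← div_eq_mul_inv, hr]
  simp
  ring

/-- The anisotropic operator is monotone at a local maximum of the difference. -/
lemma IsLocalMax.sum_pd_flux_le {n : ℕ} {v w : EuclideanSpace ℝ (Fin n) → ℝ}
    {p : Fin n → EuclideanSpace ℝ (Fin n) → ℝ} {x : EuclideanSpace ℝ (Fin n)} {ε : ℝ}
    (hm : IsLocalMax (fun y => v y - w y) x) (hε : 0 < ε) (hv : ContDiffAt ℝ 2 v x)
    (hw : ContDiffAt ℝ 2 w x) (hp : ∀ i, DifferentiableAt ℝ (p i) x)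
    (hp1 : ∀ i, -1 < p i x) :
    gradv v x = gradv w x ∧
    ∑ i, pd (fun y => ((pd v i y) ^ 2 + ε) ^ (p i y / 2) * pd v i y) i x ≤
      ∑ i, pd (fun y => ((pd w i y) ^ 2 + ε) ^ (p i y / 2) * pd w i y) i x := by
  have h1 : fderiv ℝ v x = fderiv ℝ w x := by
    have h := hm.fderiv_eq_zero
    rw [fderiv_fun_sub (hv.differentiableAt (by norm_num))
      (hw.differentiableAt (by norm_num))] at h
    exact sub_eq_zero.mp h
  have hpd : ∀ i, pd v i x = pd w i x := fun i => by simp only [pd, h1]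
  refine ⟨by simp only [gradv, hpd], Finset.sum_le_sum fun i _ => ?_⟩
  set e : EuclideanSpace ℝ (Fin n) := EuclideanSpace.single i 1 with he
  have hev : (fun y => fderiv ℝ (fun z => v z - w z) y e) =ᶠ[nhds x]
      fun y => fderiv ℝ v y e - fderiv ℝ w y e := by
    filter_upwards [hv.eventually (by simp), hw.eventually (by simp)] with y hy hy'
    rw [fderiv_fun_sub (hy.differentiableAt (by norm_num)) (hy'.differentiableAt (by norm_num))]
    rfl
  have h2 := hm.fderiv_fderiv_nonpos (hv.sub hw) e
  rw [hev.fderiv_eq, fderiv_fun_sub (hv.fderiv_apply_const e) (hw.fderiv_apply_const e)] at h2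
  have h2' : fderiv ℝ (fun y => fderiv ℝ v y e) x e ≤ fderiv ℝ (fun y => fderiv ℝ w y e) x e :=
    sub_nonpos.mp h2
  have hf := fderiv_flux_apply hε (hv.fderiv_apply_const e) (hp i) e
  have hf' := fderiv_flux_apply hε (hw.fderiv_apply_const e) (hp i) e
  change fderiv ℝ (fun y => ((fderiv ℝ v y e) ^ 2 + ε) ^ (p i y / 2) * fderiv ℝ v y e) x e ≤
    fderiv ℝ (fun y => ((fderiv ℝ w y e) ^ 2 + ε) ^ (p i y / 2) * fderiv ℝ w y e) x e
  rw [hf, hf', h1]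
  have hpos : 0 ≤ (1 + p i x) * (fderiv ℝ w x e) ^ 2 + ε := by
    have := hp1 i
    have : 0 ≤ 1 + p i x := by linarith
    positivity
  gcongr

/-- Weak parabolic maximum principle on a cylinder: if `D ≤ 0` on the parabolic boundary and
`∂ₜD ≤ 0` at every spatial local maximum where `D > 0`, then `D ≤ 0`. -/
lemma nonpos_of_deriv_nonpos_at_localMax {X : Type*} [TopologicalSpace X] {Ω : Set X}
    (hΩo : IsOpen Ω) (hΩc : IsCompact (closure Ω)) {S : ℝ} {D : ℝ → X → ℝ}
    (hD : ContinuousOn (fun q : ℝ × X => D q.1 q.2) (Icc 0 S ×ˢ closure Ω))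
    (h0 : ∀ x ∈ closure Ω, D 0 x ≤ 0)
    (hb : ∀ t ∈ Ioc 0 S, ∀ x ∈ frontier Ω, D t x ≤ 0)
    (hdiff : ∀ t ∈ Ioc 0 S, ∀ x ∈ Ω, DifferentiableAt ℝ (fun s => D s x) t)
    (hloc : ∀ t ∈ Ioc 0 S, ∀ x ∈ Ω, 0 < D t x → IsLocalMax (D t) x →
      deriv (fun s => D s x) t ≤ 0) :
    ∀ t ∈ Icc 0 S, ∀ x ∈ closure Ω, D t x ≤ 0 := by
  have key : ∀ δ > 0, ∀ t ∈ Icc 0 S, ∀ x ∈ closure Ω, D t x ≤ δ * t := by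
    intro δ hδ t₁ ht₁ x₁ hx₁
    by_contra! hlt
    obtain ⟨⟨t, x⟩, ⟨ht, hx⟩, hmax⟩ := (isCompact_Icc.prod hΩc).exists_isMaxOn
      (f := fun q : ℝ × X => D q.1 q.2 - δ * q.1) ⟨(t₁, x₁), ht₁, hx₁⟩
      (hD.sub (by fun_prop))
    have hmax' : ∀ s ∈ Icc 0 S, ∀ y ∈ closure Ω, D s y - δ * s ≤ D t x - δ * t :=
      fun s hs y hy => hmax (show (s, y) ∈ Icc 0 S ×ˢ closure Ω from ⟨hs, hy⟩)
    simp only at ht hx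
    have hp : 0 < D t x - δ * t := lt_of_lt_of_le (by linarith) (hmax' t₁ ht₁ x₁ hx₁)
    have ht0 : 0 < t := by
      rcases ht.1.eq_or_lt with h | h
      · subst h
        have := h0 x hx
        linarith
      · exact h
    have htS : t ∈ Ioc 0 S := ⟨ht0, ht.2⟩
    have hδt : 0 < δ * t := by positivity
    have hxΩ : x ∈ Ω := by
      by_contra hn
      have := hb t htS x (by rw [hΩo.frontier_eq]; exact ⟨hx, hn⟩)
      linarith
    have hlm : IsLocalMax (D t) x := by
      filter_upwards [hΩo.mem_nhds hxΩ] with y hy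
      have := hmax' t ht y (subset_closure hy)
      linarith
    have hd0 := hloc t htS x hxΩ (by linarith) hlm
    have hd : HasDerivAt (fun s => D s x - δ * s) (deriv (fun s => D s x) t - δ) t := by
      simpa using (hdiff t htS x hxΩ).hasDerivAt.fun_sub ((hasDerivAt_id t).const_mul δ)
    have hslope := (hasDerivAt_iff_tendsto_slope.mp hd).mono_left
      (nhdsWithin_mono t (fun s (hs : s ∈ Iio t) => ne_of_lt hs))
    have : 0 ≤ deriv (fun s => D s x) t - δ := by
      refine ge_of_tendsto hslope ?_
      filter_upwards [Ioo_mem_nhdsLT ht0] with s hs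
      rw [slope_def_field]
      have := hmax' s ⟨hs.1.le, hs.2.le.trans ht.2⟩ x hx
      exact div_nonneg_of_nonpos (by linarith) (by linarith [hs.2])
    linarith
  intro t ht x hx
  by_contra! hlt
  have ht1 : 0 < t + 1 := by linarith [ht.1]
  have := key (D t x / (t + 1)) (by positivity) t ht x hx
  rw [div_mul_eq_mul_div, le_div_iff₀ ht1] at this
  linarith

theorem stmt4
    (n : ℕ) (hn : 0 < n)
    (Ω : Set (EuclideanSpace ℝ (Fin n)))
    (hΩo : IsOpen Ω) (hΩconn : IsConnected Ω)
    (hΩbd : Bornology.IsBounded Ω) (hΩsph : ExteriorSphereCond Ω)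
    (T : ℝ) (hT : 0 < T)
    (γ : ℝ) (hγ : γ ∈ Ioo (0:ℝ) 1)
    (p : Fin n → EuclideanSpace ℝ (Fin n) → ℝ)
    (hp : ∀ i, C1HolderOn γ (closure Ω) (p i))
    (hp1 : ∀ i, ∀ x ∈ closure Ω, -1 < p i x)
    (ε₀ : ℝ) (hε₀ : 0 < ε₀)
    (F : EuclideanSpace ℝ (Fin n) → ℝ → EuclideanSpace ℝ (Fin n) → ℝ)
    (hF : ContinuousOn
      (fun q : EuclideanSpace ℝ (Fin n) × ℝ × EuclideanSpace ℝ (Fin n) => F q.1 q.2.1 q.2.2)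
      (closure Ω ×ˢ (univ : Set (ℝ × EuclideanSpace ℝ (Fin n)))))
    (hFmono : ∀ x ∈ closure Ω, ∀ v w : ℝ, ∀ z : EuclideanSpace ℝ (Fin n),
      w ≤ v → F x v z ≤ F x w z)
    (ψ u₀ : EuclideanSpace ℝ (Fin n) → ℝ)
    (U : Set (EuclideanSpace ℝ (Fin n))) (hU : IsOpen U) (hUΩ : closure Ω ⊆ U)
    (hu₀ : ContDiffOn ℝ 2 u₀ U)
    (hu₀ψ : ∀ x ∈ frontier Ω, u₀ x = ψ x)
    (M : ℝ) (hM : 0 < M)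
    (ε : ℝ) (hε : ε ∈ Ioc (0:ℝ) ε₀)
    (u : ℝ → EuclideanSpace ℝ (Fin n) → ℝ)
    (hu : IsClassicalSolAniso Ω T p F ψ u₀ ε u)
    (hub : ∀ t ∈ Icc 0 T, ∀ x ∈ closure Ω, |u t x| ≤ M)
    (A B K : ℝ)
    (hA : IsLUB {a : ℝ | ∃ ε' ∈ Icc (0:ℝ) ε₀, ∃ x ∈ closure Ω,
      a = |∑ i, pd (fun y => ((pd u₀ i y) ^ 2 + ε') ^ (p i y / 2) * pd u₀ i y) i x|} A)
    (hB : IsLUB {a : ℝ | ∃ x ∈ closure Ω, ∃ v ∈ Icc (-M) M,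
      a = |F x v (gradv u₀ x)|} B)
    (hK : K = A + B)
    :
    ∀ t ∈ Icc 0 T, ∀ τ ∈ Icc 0 T, τ ≤ t → ∀ x ∈ closure Ω,
      u τ x - u t x ≤ K * (t - τ) := by
  have hε0 : 0 < ε := hε.1
  have hΩc : IsCompact (closure Ω) := hΩbd.isCompact_closure
  have hpd : ∀ x ∈ Ω, ∀ i, DifferentiableAt ℝ (p i) x := fun x hx i =>
    ((hp i).1.contDiffAt (mem_of_superset (hΩo.mem_nhds hx) subset_closure)).differentiableAt
      (by norm_num)
  have hK0 : 0 ≤ K := by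
    obtain ⟨x, hx⟩ := hΩconn.nonempty
    have h1 := (abs_nonneg _).trans (hA.1 ⟨ε, ⟨hε.1.le, hε.2⟩, x, subset_closure hx, rfl⟩)
    have h2 := (abs_nonneg _).trans
      (hB.1 ⟨x, subset_closure hx, 0, ⟨by linarith, hM.le⟩, rfl⟩)
    linarith
  have hcs : ∀ h S : ℝ, 0 ≤ h → S + h ≤ T →
      ContinuousOn (fun q : ℝ × EuclideanSpace ℝ (Fin n) => u (q.1 + h) q.2)
        (Icc 0 S ×ˢ closure Ω) := by
    intro h S hh hS
    refine hu.cont.comp (f := fun q : ℝ × EuclideanSpace ℝ (Fin n) => (q.1 + h, q.2))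
      (by fun_prop) ?_
    rintro ⟨s, y⟩ ⟨hs, hy⟩
    exact ⟨⟨by linarith [hs.1], by linarith [hs.2]⟩, hy⟩
  have hinit : ∀ t ∈ Ico 0 T, ∀ x ∈ closure Ω, u₀ x - u t x - K * t ≤ 0 := by
    intro S hS
    refine nonpos_of_deriv_nonpos_at_localMax (D := fun t x => u₀ x - u t x - K * t)
      hΩo hΩc (S := S) ?_ ?_ ?_ ?_ ?_ S ⟨hS.1, le_rfl⟩
    · refine ContinuousOn.sub (ContinuousOn.sub ?_ ?_) (by fun_prop)
      · exact (hu₀.continuousOn.mono hUΩ).comp continuousOn_snd fun q hq => hq.2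
      · simpa using hcs 0 S le_rfl (by linarith [hS.2])
    · intro x hx
      simp [hu.init x hx]
    · intro t ht x hx
      simp only [hu.bdry t ⟨ht.1, ht.2.trans_lt hS.2⟩ x hx, hu₀ψ x hx]
      have := mul_nonneg hK0 ht.1.le
      linarith
    · intro t ht x hx
      have := hu.diff_t t ⟨ht.1, ht.2.trans_lt hS.2⟩ x hx
      fun_prop
    · intro t ht x hx _ hlm
      have ht' : t ∈ Ioo 0 T := ⟨ht.1, ht.2.trans_lt hS.2⟩
      have hxc := subset_closure hx
      have hd : HasDerivAt (fun s => u₀ x - u s x - K * s)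
          (-deriv (fun s => u s x) t - K) t := by
        simpa using ((hu.diff_t t ht' x hx).hasDerivAt.const_sub (u₀ x)).fun_sub
          ((hasDerivAt_id t).const_mul K)
      rw [hd.deriv, hu.eqn t ht' x hx]
      have hlm' : IsLocalMax (fun y => u₀ y - u t y) x := by
        filter_upwards [hlm] with y hy
        linarith
      obtain ⟨hg, hL⟩ := hlm'.sum_pd_flux_le hε0
        (hu₀.contDiffAt (hU.mem_nhds (hUΩ hxc))) (hu.smooth_x t ht' x hx) (hpd x hx)
        (fun i => hp1 i x hxc)
      rw [← hg]
      have h1 := hA.1 ⟨ε, ⟨hε.1.le, hε.2⟩, x, hxc, rfl⟩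
      have h2 := hB.1 ⟨x, hxc, u t x, abs_le.mp (hub t ⟨ht'.1.le, ht'.2.le⟩ x hxc), rfl⟩
      have h1' := neg_le_of_abs_le h1
      have h2' := neg_le_of_abs_le h2
      linarith
  have hshift : ∀ h ∈ Ioo 0 T, ∀ τ ∈ Ico 0 (T - h), ∀ x ∈ closure Ω,
      u τ x - u (τ + h) x - K * h ≤ 0 := by
    intro h hh S hS
    refine nonpos_of_deriv_nonpos_at_localMax (D := fun t x => u t x - u (t + h) x - K * h)
      hΩo hΩc (S := S) ?_ ?_ ?_ ?_ ?_ S ⟨hS.1, le_rfl⟩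
    · refine ContinuousOn.sub (ContinuousOn.sub ?_ ?_) (by fun_prop)
      · simpa using hcs 0 S le_rfl (by linarith [hS.2, hh.1])
      · exact hcs h S hh.1.le (by linarith [hS.2])
    · intro x hx
      simpa [hu.init x hx] using hinit h ⟨hh.1.le, hh.2⟩ x hx
    · intro t ht x hx
      simp only [hu.bdry t ⟨ht.1, by linarith [ht.2, hS.2, hh.1]⟩ x hx,
        hu.bdry (t + h) ⟨by linarith [ht.1, hh.1], by linarith [ht.2, hS.2]⟩ x hx]
      have := mul_nonneg hK0 hh.1.le
      linarith
    · intro t ht x hx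
      have h1 := hu.diff_t t ⟨ht.1, by linarith [ht.2, hS.2, hh.1]⟩ x hx
      have h2 := hu.diff_t (t + h) ⟨by linarith [ht.1, hh.1], by linarith [ht.2, hS.2]⟩ x hx
      exact (h1.sub (h2.hasDerivAt.comp_add_const t h).differentiableAt).sub_const _
    · intro t ht x hx hpos hlm
      have ht' : t ∈ Ioo 0 T := ⟨ht.1, by linarith [ht.2, hS.2, hh.1]⟩
      have hth : t + h ∈ Ioo 0 T := ⟨by linarith [ht.1, hh.1], by linarith [ht.2, hS.2]⟩
      have hxc := subset_closure hx
      have hd : HasDerivAt (fun s => u s x - u (s + h) x - K * h)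
          (deriv (fun s => u s x) t - deriv (fun s => u s x) (t + h)) t :=
        ((hu.diff_t t ht' x hx).hasDerivAt.sub
          ((hu.diff_t (t + h) hth x hx).hasDerivAt.comp_add_const t h)).sub_const _
      rw [hd.deriv, hu.eqn t ht' x hx, hu.eqn (t + h) hth x hx]
      have hlm' : IsLocalMax (fun y => u t y - u (t + h) y) x := by
        filter_upwards [hlm] with y hy
        linarith
      obtain ⟨hg, hL⟩ := hlm'.sum_pd_flux_le hε0 (hu.smooth_x t ht' x hx)
        (hu.smooth_x (t + h) hth x hx) (hpd x hx) (fun i => hp1 i x hxc)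
      have hKh := mul_nonneg hK0 hh.1.le
      have hF' := hFmono x hxc (u t x) (u (t + h) x) (gradv (u (t + h)) x) (by linarith)
      rw [hg]
      linarith
  intro t ht τ hτ hτt x hx
  rcases hτt.eq_or_lt with rfl | hlt
  · simp
  have hτT : τ < T := hlt.trans_le ht.2
  have hcl : closure (Ico τ T) = Icc τ T := closure_Ico hτT.ne
  have hux : ContinuousOn (fun s => u s x) (Icc τ T) :=
    hu.cont.comp (f := fun s : ℝ => (s, x)) (by fun_prop)
      fun s hs => ⟨⟨hτ.1.trans hs.1, hs.2⟩, hx⟩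
  refine le_on_closure (s := Ico τ T) (f := fun s => u τ x - u s x)
    (g := fun s => K * (s - τ)) ?_ ?_ (by fun_prop) (hcl ▸ ⟨hτt, ht.2⟩)
  · intro s hs
    rcases hs.1.eq_or_lt with rfl | hlt'
    · simp
    have := hshift (s - τ) ⟨by linarith, by linarith [hs.2, hτ.1]⟩ τ
      ⟨hτ.1, by linarith [hs.2]⟩ x hx
    simp only [add_sub_cancel] at this
    linarith
  · rw [hcl]
    exact continuousOn_const.sub hux
end
end

section
/- Let u_ε be a classical solution of the regularized isotropic problem with ε ∈ (0,ε₀], satisfying |u_ε| ≤ M on Q̄_T, and suppose F satisfies the monotonicity condition F(x,u,z) ≤ F(x,v,z) whenever u ≥ v. Then the time derivative satisfies |∂_t u_ε(t,x)| ≤ K₁ for all (t,x) ∈ Q_T, where K₁ is the constant defined in the context. -/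
open Set Filter MeasureTheory Metric

noncomputable section

/-- Classical solution of the regularized isotropic problem
`u_t = div((|∇u|² + ε)^{p(x)/2} ∇u) + F(x, u, ∇u)` in `Q_T = (0,T) × Ω`,
with `u = ψ` on `∂Ω × (0,T)` and `u(0,·) = u₀` in `Ω`. -/
structure IsClassicalSolIso {n : ℕ} (Ω : Set (EuclideanSpace ℝ (Fin n))) (T : ℝ)
    (p : EuclideanSpace ℝ (Fin n) → ℝ)
    (F : EuclideanSpace ℝ (Fin n) → ℝ → EuclideanSpace ℝ (Fin n) → ℝ)
    (ψ u₀ : EuclideanSpace ℝ (Fin n) → ℝ) (ε : ℝ)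
    (u : ℝ → EuclideanSpace ℝ (Fin n) → ℝ) : Prop where
  cont : ContinuousOn (fun q : ℝ × EuclideanSpace ℝ (Fin n) => u q.1 q.2)
      (Icc 0 T ×ˢ closure Ω)
  diff_t : ∀ t ∈ Ioo 0 T, ∀ x ∈ Ω, DifferentiableAt ℝ (fun s => u s x) t
  smooth_x : ∀ t ∈ Ioo 0 T, ∀ x ∈ Ω, ContDiffAt ℝ 2 (u t) x
  cont_ut : ContinuousOn
      (fun q : ℝ × EuclideanSpace ℝ (Fin n) => deriv (fun s => u s q.2) q.1) (Ioo 0 T ×ˢ Ω)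
  cont_ux : ∀ i, ContinuousOn
      (fun q : ℝ × EuclideanSpace ℝ (Fin n) => pd (u q.1) i q.2) (Ioo 0 T ×ˢ Ω)
  cont_uxx : ∀ i j, ContinuousOn
      (fun q : ℝ × EuclideanSpace ℝ (Fin n) => pd (fun y => pd (u q.1) j y) i q.2)
      (Ioo 0 T ×ˢ Ω)
  eqn : ∀ t ∈ Ioo 0 T, ∀ x ∈ Ω,
      deriv (fun s => u s x) t =
        (∑ i, pd (fun y => (‖gradv (u t) y‖ ^ 2 + ε) ^ (p y / 2) * pd (u t) i y) i x)
          + F x (u t x) (gradv (u t) x)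
  bdry : ∀ t ∈ Ioo 0 T, ∀ x ∈ frontier Ω, u t x = ψ x
  init : ∀ x ∈ closure Ω, u 0 x = u₀ x

/-- The diffusion operator `div((|∇f|² + ε)^{p(x)/2} ∇f)`. -/
def isoDiffusion {n : ℕ} (p : EuclideanSpace ℝ (Fin n) → ℝ) (ε : ℝ)
    (f : EuclideanSpace ℝ (Fin n) → ℝ) (x : EuclideanSpace ℝ (Fin n)) : ℝ :=
  ∑ i, pd (fun y => (‖gradv f y‖ ^ 2 + ε) ^ (p y / 2) * pd f i y) i x

lemma norm_gradv_sq {n : ℕ} (f : EuclideanSpace ℝ (Fin n) → ℝ) (x : EuclideanSpace ℝ (Fin n)) :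
    ‖gradv f x‖ ^ 2 = ∑ i, pd f i x ^ 2 := by
  simp [EuclideanSpace.real_norm_sq_eq, gradv]

lemma pd_add_const {n : ℕ} (f : EuclideanSpace ℝ (Fin n) → ℝ) (c : ℝ) :
    pd (fun x => f x + c) = pd f := by
  funext i x
  simp [pd, fderiv_add_const]

lemma gradv_add_const {n : ℕ} (f : EuclideanSpace ℝ (Fin n) → ℝ) (c : ℝ) :
    gradv (fun x => f x + c) = gradv f := by
  funext x
  simp [gradv, pd_add_const]

lemma isoDiffusion_add_const {n : ℕ} (p : EuclideanSpace ℝ (Fin n) → ℝ) (ε : ℝ)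
    (f : EuclideanSpace ℝ (Fin n) → ℝ) (c : ℝ) :
    isoDiffusion p ε (fun x => f x + c) = isoDiffusion p ε f := by
  funext x
  simp [isoDiffusion, gradv_add_const, pd_add_const]

lemma Matrix.PosSemidef.quadForm_le_trace_mul {n : ℕ} {G : Matrix (Fin n) (Fin n) ℝ}
    (hG : G.PosSemidef) (z : Fin n → ℝ) :
    ∑ i, ∑ j, z i * z j * G i j ≤ (∑ i, G i i) * ∑ i, z i ^ 2 := by
  obtain ⟨m, v, rfl⟩ := Matrix.posSemidef_iff_eq_sum_vecMulVec.mp hG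
  have hquad : ∑ i, ∑ j, z i * z j * (∑ k, Matrix.vecMulVec (v k) (star (v k))) i j
      = ∑ k, (∑ i, v k i * z i) ^ 2 := by
    simp only [Matrix.sum_apply, Matrix.vecMulVec_apply, star_trivial, Finset.mul_sum]
    rw [Finset.sum_comm_cycle]
    refine Finset.sum_congr rfl fun k _ => ?_
    rw [Finset.sum_comm, sq, Finset.sum_mul_sum]
    refine Finset.sum_congr rfl fun i _ => Finset.sum_congr rfl fun j _ => ?_
    ring
  have htrace : ∑ i, (∑ k, Matrix.vecMulVec (v k) (star (v k))) i i = ∑ k, ∑ i, v k i ^ 2 := by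
    simp only [Matrix.sum_apply, Matrix.vecMulVec_apply, star_trivial, sq]
    rw [Finset.sum_comm]
  rw [hquad, htrace, Finset.sum_mul]
  exact Finset.sum_le_sum fun k _ => Finset.sum_mul_sq_le_sq_mul_sq _ _ _

lemma IsLocalMax.fderiv_fderiv_apply_nonpos {E : Type*} [NormedAddCommGroup E] [NormedSpace ℝ E]
    {w : E → ℝ} {x : E} (hw : ContDiffAt ℝ 2 w x) (hmax : IsLocalMax w x) (d : E) :
    fderiv ℝ (fderiv ℝ w) x d d ≤ 0 := by
  let γ : ℝ → E := fun s => x + s • d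
  have hγ (s : ℝ) : HasDerivAt γ d s := by
    simpa [γ] using ((hasDerivAt_id s).smul_const d).const_add x
  have hγ0 : γ 0 = x := by simp [γ]
  have hγt : Tendsto γ (nhds 0) (nhds x) := by
    simpa [hγ0] using (hγ 0).continuousAt.tendsto
  have hderiv : deriv (w ∘ γ) =ᶠ[nhds 0] fun s => fderiv ℝ w (γ s) d := by
    have h1 : ∀ᶠ y in nhds x, DifferentiableAt ℝ w y :=
      (hw.eventually (by simp)).mono fun y hy => hy.differentiableAt (by simp)
    filter_upwards [hγt.eventually h1] with s hs
    exact (hs.hasFDerivAt.comp_hasDerivAt s (hγ s)).deriv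
  have hdd : deriv (deriv (w ∘ γ)) 0 = fderiv ℝ (fderiv ℝ w) x d d := by
    rw [hderiv.deriv_eq]
    have h2 : HasFDerivAt (fderiv ℝ w) (fderiv ℝ (fderiv ℝ w) x) (γ 0) := by
      rw [hγ0]
      exact ((hw.fderiv_right (m := 1) (by norm_num)).differentiableAt (by simp)).hasFDerivAt
    have h3 := h2.comp_hasDerivAt (0 : ℝ) (hγ 0)
    simpa using (h3.clm_apply (hasDerivAt_const (0 : ℝ) d)).deriv
  have hmax' : IsLocalMax (w ∘ γ) 0 := by
    simpa [IsLocalMax, IsMaxFilter, hγ0] using hγt.eventually hmax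
  by_contra! hpos
  have hcont : ContinuousAt (w ∘ γ) 0 :=
    ContinuousAt.comp (by rw [hγ0]; exact hw.continuousAt) (hγ 0).continuousAt
  have hmin := isLocalMin_of_deriv_deriv_pos (hdd ▸ hpos) hmax'.deriv_eq_zero hcont
  have hconst : w ∘ γ =ᶠ[nhds 0] fun _ => (w ∘ γ) 0 := by
    filter_upwards [hmin, hmax'] with s h1 h2 using le_antisymm h2 h1
  rw [← hdd, hconst.deriv.deriv_eq] at hpos
  simp at hpos

lemma ContDiffAt.hasFDerivAt_pd {n : ℕ} {f : EuclideanSpace ℝ (Fin n) → ℝ}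
    {x : EuclideanSpace ℝ (Fin n)} (hf : ContDiffAt ℝ 2 f x) (j : Fin n) :
    HasFDerivAt (pd f j)
      ((fderiv ℝ (fderiv ℝ f) x).flip (EuclideanSpace.single j 1)) x := by
  have h := ((hf.fderiv_right (m := 1) (by norm_num)).differentiableAt (by simp)).hasFDerivAt
  exact (h.clm_apply (hasFDerivAt_const (EuclideanSpace.single j (1 : ℝ)) x)).congr_fderiv
    (by ext; simp)

lemma isoDiffusion_eq {n : ℕ} {p f : EuclideanSpace ℝ (Fin n) → ℝ} {ε : ℝ}
    {x : EuclideanSpace ℝ (Fin n)} (hf : ContDiffAt ℝ 2 f x) (hp : DifferentiableAt ℝ p x)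
    (hε : 0 < ε) :
    isoDiffusion p ε f x =
      (‖gradv f x‖ ^ 2 + ε) ^ (p x / 2 - 1) *
        (p x * ∑ i, ∑ j, pd f i x * pd f j x * fderiv ℝ (fderiv ℝ f) x
            (EuclideanSpace.single i 1) (EuclideanSpace.single j 1)
          + (‖gradv f x‖ ^ 2 + ε) * ∑ i, fderiv ℝ (fderiv ℝ f) x
            (EuclideanSpace.single i 1) (EuclideanSpace.single i 1))
      + (‖gradv f x‖ ^ 2 + ε) ^ (p x / 2) * Real.log (‖gradv f x‖ ^ 2 + ε) / 2 *
        ∑ i, pd p i x * pd f i x := by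
  have hpos : 0 < ‖gradv f x‖ ^ 2 + ε := by positivity
  have hpow : (‖gradv f x‖ ^ 2 + ε) ^ (p x / 2)
      = (‖gradv f x‖ ^ 2 + ε) ^ (p x / 2 - 1) * (‖gradv f x‖ ^ 2 + ε) := by
    rw [← Real.rpow_add_one hpos.ne']; ring_nf
  have hG : HasFDerivAt (fun y => ‖gradv f y‖ ^ 2 + ε)
      (∑ j, (2 * pd f j x) •
        (fderiv ℝ (fderiv ℝ f) x).flip (EuclideanSpace.single j 1)) x := by
    simp only [norm_gradv_sq]
    refine (HasFDerivAt.fun_sum fun j _ => ?_).add_const ε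
    simpa using (hf.hasFDerivAt_pd j).pow 2
  have hpw := hG.rpow (hp.hasFDerivAt.mul_const (2⁻¹ : ℝ)) hpos
  have hterm (i : Fin n) :
      pd (fun y => (‖gradv f y‖ ^ 2 + ε) ^ (p y / 2) * pd f i y) i x =
        (‖gradv f x‖ ^ 2 + ε) ^ (p x / 2 - 1) *
        (p x * ∑ j, pd f i x * pd f j x * fderiv ℝ (fderiv ℝ f) x
            (EuclideanSpace.single i 1) (EuclideanSpace.single j 1)
          + (‖gradv f x‖ ^ 2 + ε) * fderiv ℝ (fderiv ℝ f) x
            (EuclideanSpace.single i 1) (EuclideanSpace.single i 1))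
      + (‖gradv f x‖ ^ 2 + ε) ^ (p x / 2) * Real.log (‖gradv f x‖ ^ 2 + ε) / 2 *
        (pd p i x * pd f i x) := by
    have h := (hpw.fun_mul (hf.hasFDerivAt_pd i)).fderiv
    simp only [← div_eq_mul_inv] at h
    rw [pd, h]
    have hsum : ∑ j, 2 * pd f j x * fderiv ℝ (fderiv ℝ f) x
          (EuclideanSpace.single i 1) (EuclideanSpace.single j 1) * pd f i x
        = 2 * ∑ j, pd f i x * pd f j x * fderiv ℝ (fderiv ℝ f) x
            (EuclideanSpace.single i 1) (EuclideanSpace.single j 1) := by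
      rw [Finset.mul_sum]
      exact Finset.sum_congr rfl fun j _ => by ring
    rw [← Finset.sum_mul] at hsum
    simp only [add_apply, smul_apply,
      sum_apply, ContinuousLinearMap.flip_apply, smul_eq_mul, hpow]
    simp only [pd] at hsum ⊢
    linear_combination ((‖gradv f x‖ ^ 2 + ε) ^ (p x / 2 - 1) * p x / 2) * hsum
  rw [isoDiffusion, Finset.sum_congr rfl fun i _ => hterm i]
  simp only [Finset.sum_add_distrib, ← Finset.mul_sum]

lemma isoDiffusion_le_of_isLocalMax_sub {n : ℕ} {p f g : EuclideanSpace ℝ (Fin n) → ℝ} {ε : ℝ}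
    {x : EuclideanSpace ℝ (Fin n)} (hf : ContDiffAt ℝ 2 f x) (hg : ContDiffAt ℝ 2 g x)
    (hp : DifferentiableAt ℝ p x) (hp1 : -1 < p x) (hε : 0 < ε)
    (hmax : IsLocalMax (fun y => f y - g y) x) :
    gradv f x = gradv g x ∧ isoDiffusion p ε f x ≤ isoDiffusion p ε g x := by
  have hd : fderiv ℝ f x = fderiv ℝ g x := by
    have h := hmax.fderiv_eq_zero
    rwa [fderiv_fun_sub (hf.differentiableAt (by simp)) (hg.differentiableAt (by simp)),
      sub_eq_zero] at h
  have hpd (i : Fin n) : pd f i x = pd g i x := by simp [pd, hd]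
  have hgrad : gradv f x = gradv g x := by simp [gradv, hpd]
  refine ⟨hgrad, ?_⟩
  have hw : ContDiffAt ℝ 2 (fun y => f y - g y) x := hf.sub hg
  have hsub : fderiv ℝ (fderiv ℝ fun y => f y - g y) x
      = fderiv ℝ (fderiv ℝ f) x - fderiv ℝ (fderiv ℝ g) x := by
    have h : (fderiv ℝ fun y => f y - g y) =ᶠ[nhds x] fun y => fderiv ℝ f y - fderiv ℝ g y := by
      filter_upwards [hf.eventually (by simp), hg.eventually (by simp)] with y h1 h2
      exact fderiv_fun_sub (h1.differentiableAt (by simp)) (h2.differentiableAt (by simp))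
    rw [h.fderiv_eq]
    exact fderiv_fun_sub ((hf.fderiv_right (m := 1) (by norm_num)).differentiableAt (by simp))
      ((hg.fderiv_right (m := 1) (by norm_num)).differentiableAt (by simp))
  let G : Matrix (Fin n) (Fin n) ℝ := Matrix.of fun i j =>
    fderiv ℝ (fderiv ℝ g) x (EuclideanSpace.single i 1) (EuclideanSpace.single j 1) -
      fderiv ℝ (fderiv ℝ f) x (EuclideanSpace.single i 1) (EuclideanSpace.single j 1)
  have hquad (z : Fin n → ℝ) : 0 ≤ ∑ i, ∑ j, z i * z j * G i j := by
    have h := hmax.fderiv_fderiv_apply_nonpos hw (∑ i, z i • EuclideanSpace.single i (1 : ℝ))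
    rw [hsub] at h
    simp only [map_sum, map_smul, sum_apply, smul_apply,
      sub_apply, smul_eq_mul, Finset.mul_sum] at h
    rw [← neg_nonpos, ← Finset.sum_neg_distrib]
    rw [Finset.sum_comm] at h
    convert h using 2 with i _
    rw [← Finset.sum_neg_distrib]
    refine Finset.sum_congr rfl fun j _ => ?_
    simp only [G, Matrix.of_apply]
    ring
  have hsymf := hf.isSymmSndFDerivAt (by simp)
  have hsymg := hg.isSymmSndFDerivAt (by simp)
  have hG : G.PosSemidef := by
    refine Matrix.PosSemidef.of_dotProduct_mulVec_nonneg ?_ fun z => ?_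
    · ext i j
      simp [G, hsymf (EuclideanSpace.single i 1), hsymg (EuclideanSpace.single i 1)]
    · refine (hquad z).trans_eq ?_
      simp only [dotProduct, Matrix.mulVec, star_trivial, Finset.mul_sum]
      exact Finset.sum_congr rfl fun i _ => Finset.sum_congr rfl fun j _ => by ring
  have hle := hG.quadForm_le_trace_mul fun i => pd g i x
  have h0 := hquad fun i => pd g i x
  have htr : 0 ≤ ∑ i, G i i := Finset.sum_nonneg fun i _ => hG.diag_nonneg
  have hpos : 0 < ‖gradv g x‖ ^ 2 + ε := by positivity
  have hdiff : 0 ≤ (‖gradv g x‖ ^ 2 + ε) ^ (p x / 2 - 1) *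
      (p x * ∑ i, ∑ j, pd g i x * pd g j x * G i j
        + (‖gradv g x‖ ^ 2 + ε) * ∑ i, G i i) := by
    refine mul_nonneg (Real.rpow_nonneg hpos.le _) ?_
    rw [← norm_gradv_sq] at hle
    nlinarith [mul_nonneg htr hε.le]
  rw [isoDiffusion_eq hf hp hε, isoDiffusion_eq hg hp hε, ← sub_nonneg]
  simp only [hpd, hgrad]
  convert hdiff using 1
  simp only [G, Matrix.of_apply, mul_sub, Finset.sum_sub_distrib]
  ring

lemma deriv_nonneg_of_forall_le_left {g : ℝ → ℝ} {t : ℝ} (ht : 0 < t)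
    (hg : DifferentiableAt ℝ g t) (hmax : ∀ s ∈ Icc 0 t, g s ≤ g t) : 0 ≤ deriv g t := by
  have hlim := (hasDerivWithinAt_iff_tendsto_slope' (s := Iio t) (by simp)).mp
    hg.hasDerivAt.hasDerivWithinAt
  refine ge_of_tendsto hlim ?_
  filter_upwards [Ioo_mem_nhdsLT ht] with s hs
  rw [slope_def_field]
  exact div_nonneg_of_nonpos (sub_nonpos.mpr (hmax s ⟨hs.1.le, hs.2.le⟩))
    (sub_nonpos.mpr hs.2.le)

lemma isoDiffusion_comparison {n : ℕ} {Ω : Set (EuclideanSpace ℝ (Fin n))}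
    (hΩo : IsOpen Ω) (hΩbd : Bornology.IsBounded Ω) {S : ℝ}
    {p : EuclideanSpace ℝ (Fin n) → ℝ} (hp : ∀ x ∈ Ω, DifferentiableAt ℝ p x)
    (hp1 : ∀ x ∈ Ω, -1 < p x) {ε : ℝ} (hε : 0 < ε)
    {F : EuclideanSpace ℝ (Fin n) → ℝ → EuclideanSpace ℝ (Fin n) → ℝ}
    (hF : ∀ x ∈ Ω, ∀ v w : ℝ, ∀ z, w ≤ v → F x v z ≤ F x w z)
    {u v : ℝ → EuclideanSpace ℝ (Fin n) → ℝ}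
    (hu : ContinuousOn (fun q : ℝ × EuclideanSpace ℝ (Fin n) => u q.1 q.2)
      (Icc 0 S ×ˢ closure Ω))
    (hv : ContinuousOn (fun q : ℝ × EuclideanSpace ℝ (Fin n) => v q.1 q.2)
      (Icc 0 S ×ˢ closure Ω))
    (hut : ∀ t ∈ Ioc 0 S, ∀ x ∈ Ω, DifferentiableAt ℝ (fun s => u s x) t)
    (hvt : ∀ t ∈ Ioc 0 S, ∀ x ∈ Ω, DifferentiableAt ℝ (fun s => v s x) t)
    (hux : ∀ t ∈ Ioc 0 S, ∀ x ∈ Ω, ContDiffAt ℝ 2 (u t) x)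
    (hvx : ∀ t ∈ Ioc 0 S, ∀ x ∈ Ω, ContDiffAt ℝ 2 (v t) x)
    (hsub : ∀ t ∈ Ioc 0 S, ∀ x ∈ Ω, deriv (fun s => u s x) t ≤
      isoDiffusion p ε (u t) x + F x (u t x) (gradv (u t) x))
    (hsuper : ∀ t ∈ Ioc 0 S, ∀ x ∈ Ω,
      isoDiffusion p ε (v t) x + F x (v t x) (gradv (v t) x) ≤ deriv (fun s => v s x) t)
    (hinit : ∀ x ∈ closure Ω, u 0 x ≤ v 0 x)
    (hbdry : ∀ t ∈ Ioc 0 S, ∀ x ∈ frontier Ω, u t x ≤ v t x) :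
    ∀ t ∈ Icc 0 S, ∀ x ∈ closure Ω, u t x ≤ v t x := by
  intro t₁ ht₁ x₁ hx₁
  by_contra! hlt
  have ht₁' : 0 < t₁ + 1 := by linarith [ht₁.1]
  obtain ⟨δ, hδ, hδ₁⟩ : ∃ δ > 0, 0 < u t₁ x₁ - v t₁ x₁ - δ * t₁ := by
    have hd : 0 < u t₁ x₁ - v t₁ x₁ := sub_pos.mpr hlt
    refine ⟨(u t₁ x₁ - v t₁ x₁) / (t₁ + 1), by positivity, ?_⟩
    have : u t₁ x₁ - v t₁ x₁ - (u t₁ x₁ - v t₁ x₁) / (t₁ + 1) * t₁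
        = (u t₁ x₁ - v t₁ x₁) / (t₁ + 1) := by field_simp; ring
    rw [this]
    positivity
  have hcompact : IsCompact (Icc 0 S ×ˢ closure Ω) :=
    isCompact_Icc.prod hΩbd.isCompact_closure
  have hcont : ContinuousOn
      (fun q : ℝ × EuclideanSpace ℝ (Fin n) => u q.1 q.2 - v q.1 q.2 - δ * q.1)
      (Icc 0 S ×ˢ closure Ω) := (hu.sub hv).sub (by fun_prop)
  obtain ⟨⟨t, x⟩, ⟨ht, hx⟩, hmax⟩ := hcompact.exists_isMaxOn ⟨(t₁, x₁), ht₁, hx₁⟩ hcont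
  have hle (s : ℝ) (hs : s ∈ Icc 0 S) (y : EuclideanSpace ℝ (Fin n)) (hy : y ∈ closure Ω) :
      u s y - v s y - δ * s ≤ u t x - v t x - δ * t := hmax (mk_mem_prod hs hy)
  have hpos : 0 < u t x - v t x - δ * t := hδ₁.trans_le (hle t₁ ht₁ x₁ hx₁)
  simp only at ht hx
  have ht0 : 0 < t := by
    refine lt_of_le_of_ne ht.1 fun h => ?_
    subst h
    linarith [hinit x hx]
  have htS : t ∈ Ioc 0 S := ⟨ht0, ht.2⟩
  have hδt : 0 < δ * t := mul_pos hδ ht0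
  have hxΩ : x ∈ Ω := by
    by_contra hxΩ
    have := hbdry t htS x (by rw [hΩo.frontier_eq]; exact ⟨hx, hxΩ⟩)
    linarith
  have hlocal : IsLocalMax (fun y => u t y - v t y) x := by
    filter_upwards [hΩo.mem_nhds hxΩ] with y hy
    linarith [hle t ht y (subset_closure hy)]
  obtain ⟨hgrad, hdiff⟩ := isoDiffusion_le_of_isLocalMax_sub (hux t htS x hxΩ) (hvx t htS x hxΩ)
    (hp x hxΩ) (hp1 x hxΩ) hε hlocal
  have htime : δ ≤ deriv (fun s => u s x) t - deriv (fun s => v s x) t := by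
    have hd := ((hut t htS x hxΩ).hasDerivAt.sub (hvt t htS x hxΩ).hasDerivAt).sub
      ((hasDerivAt_id t).const_mul δ)
    have h := deriv_nonneg_of_forall_le_left ht0 hd.differentiableAt fun s hs =>
      hle s ⟨hs.1, hs.2.trans ht.2⟩ x hx
    rw [hd.deriv] at h
    linarith
  have h1 := hsub t htS x hxΩ
  have h2 := hsuper t htS x hxΩ
  have h3 := hF x hxΩ (u t x) (v t x) (gradv (v t) x) (by linarith)
  rw [hgrad] at h1
  linarith

theorem stmt7
    (n : ℕ) (hn : 0 < n)
    (Ω : Set (EuclideanSpace ℝ (Fin n)))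
    (hΩo : IsOpen Ω) (hΩconn : IsConnected Ω)
    (hΩbd : Bornology.IsBounded Ω) (hΩsph : ExteriorSphereCond Ω)
    (T : ℝ) (hT : 0 < T)
    (γ : ℝ) (hγ : γ ∈ Ioo (0:ℝ) 1)
    (p : EuclideanSpace ℝ (Fin n) → ℝ)
    (hp : C1HolderOn γ (closure Ω) p)
    (hp1 : ∀ x ∈ closure Ω, -1 < p x)
    (ε₀ : ℝ) (hε₀ : 0 < ε₀)
    (F : EuclideanSpace ℝ (Fin n) → ℝ → EuclideanSpace ℝ (Fin n) → ℝ)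
    (hF : ContinuousOn
      (fun q : EuclideanSpace ℝ (Fin n) × ℝ × EuclideanSpace ℝ (Fin n) => F q.1 q.2.1 q.2.2)
      (closure Ω ×ˢ (univ : Set (ℝ × EuclideanSpace ℝ (Fin n)))))
    (hFmono : ∀ x ∈ closure Ω, ∀ v w : ℝ, ∀ z : EuclideanSpace ℝ (Fin n),
      w ≤ v → F x v z ≤ F x w z)
    (ψ u₀ : EuclideanSpace ℝ (Fin n) → ℝ)
    (U : Set (EuclideanSpace ℝ (Fin n))) (hU : IsOpen U) (hUΩ : closure Ω ⊆ U)
    (hu₀ : ContDiffOn ℝ 2 u₀ U)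
    (hu₀ψ : ∀ x ∈ frontier Ω, u₀ x = ψ x)
    (M : ℝ) (hM : 0 < M)
    (ε : ℝ) (hε : ε ∈ Ioc (0:ℝ) ε₀)
    (u : ℝ → EuclideanSpace ℝ (Fin n) → ℝ)
    (hu : IsClassicalSolIso Ω T p F ψ u₀ ε u)
    (hub : ∀ t ∈ Icc 0 T, ∀ x ∈ closure Ω, |u t x| ≤ M)
    (A B K₁ : ℝ)
    (hA : IsLUB {a : ℝ | ∃ ε' ∈ Icc (0:ℝ) ε₀, ∃ x ∈ closure Ω,
      a = |∑ i, pd (fun y => (‖gradv u₀ y‖ ^ 2 + ε') ^ (p y / 2) * pd u₀ i y) i x|} A)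
    (hB : IsLUB {a : ℝ | ∃ x ∈ closure Ω, ∃ v ∈ Icc (-M) M,
      a = |F x v (gradv u₀ x)|} B)
    (hK₁ : K₁ = A + B)
    :
    ∀ t ∈ Ioo 0 T, ∀ x ∈ Ω, |deriv (fun s => u s x) t| ≤ K₁ := by
  obtain ⟨x₀, hx₀⟩ := hΩconn.nonempty
  have hx₀' := subset_closure (s := Ω) hx₀
  have hu₀M (x) (hx : x ∈ closure Ω) : u₀ x ∈ Icc (-M) M := by
    have h := hub 0 ⟨le_rfl, hT.le⟩ x hx
    rw [hu.init x hx] at h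
    exact abs_le.mp h
  have hAle (x) (hx : x ∈ Ω) : |isoDiffusion p ε u₀ x| ≤ A :=
    hA.1 ⟨ε, ⟨hε.1.le, hε.2⟩, x, subset_closure hx, rfl⟩
  have hBle (x) (hx : x ∈ Ω) : |F x (u₀ x) (gradv u₀ x)| ≤ B :=
    hB.1 ⟨x, subset_closure hx, u₀ x, hu₀M x (subset_closure hx), rfl⟩
  have hK0 : 0 ≤ K₁ := by
    linarith [(abs_nonneg _).trans (hAle x₀ hx₀), (abs_nonneg _).trans (hBle x₀ hx₀)]
  have hpd (x) (hx : x ∈ Ω) : DifferentiableAt ℝ p x :=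
    (hp.1.contDiffAt (mem_of_superset (hΩo.mem_nhds hx) subset_closure)).differentiableAt
      (by simp)
  have hp1' (x) (hx : x ∈ Ω) := hp1 x (subset_closure hx)
  have hF' (x) (hx : x ∈ Ω) := hFmono x (subset_closure hx)
  have heqn (t) (ht : t ∈ Ioo 0 T) (x) (hx : x ∈ Ω) : deriv (fun s => u s x) t =
      isoDiffusion p ε (u t) x + F x (u t x) (gradv (u t) x) := hu.eqn t ht x hx
  have hbdry (t) (ht : t ∈ Ico 0 T) (x) (hx : x ∈ frontier Ω) : u t x = u₀ x := by
    rcases ht.1.eq_or_lt with rfl | h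
    · exact hu.init x (frontier_subset_closure hx)
    · rw [hu.bdry t ⟨h, ht.2⟩ x hx, hu₀ψ x hx]
  have hucont {S : ℝ} (hS : S < T) : ContinuousOn
      (fun q : ℝ × EuclideanSpace ℝ (Fin n) => u q.1 q.2) (Icc 0 S ×ˢ closure Ω) :=
    hu.cont.mono (prod_mono (Icc_subset_Icc le_rfl hS.le) le_rfl)
  have hu₀C (x) (hx : x ∈ Ω) : ContDiffAt ℝ 2 u₀ x :=
    hu₀.contDiffAt (hU.mem_nhds (hUΩ (subset_closure hx)))
  have hbarrier (c : ℝ) (S : ℝ) : ContinuousOn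
      (fun q : ℝ × EuclideanSpace ℝ (Fin n) => u₀ q.2 + c * q.1) (Icc 0 S ×ˢ closure Ω) :=
    ((hu₀.continuousOn.mono hUΩ).comp continuousOn_snd fun q hq => hq.2).add (by fun_prop)
  have hbarrier_deriv (c t : ℝ) (x : EuclideanSpace ℝ (Fin n)) :
      HasDerivAt (fun s => u₀ x + c * s) c t := by
    simpa using ((hasDerivAt_id t).const_mul c).const_add (u₀ x)
  have hupper (S) (hS : S ∈ Ico 0 T) (x) (hx : x ∈ closure Ω) : u S x ≤ u₀ x + K₁ * S := by
    have hST (t) (ht : t ∈ Ioc 0 S) : t ∈ Ioo 0 T := ⟨ht.1, ht.2.trans_lt hS.2⟩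
    refine isoDiffusion_comparison (v := fun t x => u₀ x + K₁ * t) hΩo hΩbd hpd hp1' hε.1 hF'
      (hucont hS.2) (hbarrier K₁ S) (fun t ht => hu.diff_t t (hST t ht))
      (fun t _ x _ => (hbarrier_deriv K₁ t x).differentiableAt)
      (fun t ht => hu.smooth_x t (hST t ht)) (fun t _ x hx => (hu₀C x hx).add contDiffAt_const)
      (fun t ht x hx => (heqn t (hST t ht) x hx).le) (fun t ht x hx => ?_)
      (fun x hx => by simp [hu.init x hx])
      (fun t ht x hx => ?_) S ⟨hS.1, le_rfl⟩ x hx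
    · rw [(hbarrier_deriv K₁ t x).deriv, isoDiffusion_add_const, gradv_add_const]
      have := hF' x hx (u₀ x + K₁ * t) (u₀ x) (gradv u₀ x)
        (le_add_of_nonneg_right (mul_nonneg hK0 ht.1.le))
      linarith [(abs_le.mp (hAle x hx)).2, (abs_le.mp (hBle x hx)).2]
    · rw [hbdry t ⟨ht.1.le, (hST t ht).2⟩ x hx]
      exact le_add_of_nonneg_right (mul_nonneg hK0 ht.1.le)
  have hlower (S) (hS : S ∈ Ico 0 T) (x) (hx : x ∈ closure Ω) : u₀ x + -K₁ * S ≤ u S x := by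
    have hST (t) (ht : t ∈ Ioc 0 S) : t ∈ Ioo 0 T := ⟨ht.1, ht.2.trans_lt hS.2⟩
    refine isoDiffusion_comparison (u := fun t x => u₀ x + -K₁ * t) hΩo hΩbd hpd hp1' hε.1 hF'
      (hbarrier (-K₁) S) (hucont hS.2)
      (fun t _ x _ => (hbarrier_deriv (-K₁) t x).differentiableAt)
      (fun t ht => hu.diff_t t (hST t ht))
      (fun t _ x hx => (hu₀C x hx).add contDiffAt_const) (fun t ht => hu.smooth_x t (hST t ht))
      (fun t ht x hx => ?_) (fun t ht x hx => (heqn t (hST t ht) x hx).ge)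
      (fun x hx => by simp [hu.init x hx])
      (fun t ht x hx => ?_) S ⟨hS.1, le_rfl⟩ x hx
    · rw [(hbarrier_deriv (-K₁) t x).deriv, isoDiffusion_add_const, gradv_add_const]
      have := hF' x hx (u₀ x) (u₀ x + -K₁ * t) (gradv u₀ x)
        (by nlinarith [mul_nonneg hK0 ht.1.le])
      linarith [(abs_le.mp (hAle x hx)).1, (abs_le.mp (hBle x hx)).1]
    · rw [hbdry t ⟨ht.1.le, (hST t ht).2⟩ x hx]
      nlinarith [mul_nonneg hK0 ht.1.le]
  have hshift_cont {h S : ℝ} (hh : 0 ≤ h) (hS : S + h < T) : ContinuousOn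
      (fun q : ℝ × EuclideanSpace ℝ (Fin n) => u (q.1 + h) q.2) (Icc 0 S ×ˢ closure Ω) :=
    hu.cont.comp (f := fun q : ℝ × EuclideanSpace ℝ (Fin n) => (q.1 + h, q.2)) (by fun_prop)
      fun q hq => ⟨⟨by linarith [hq.1.1], by linarith [hq.1.2]⟩, hq.2⟩
  have hshift_deriv {h t : ℝ} {x : EuclideanSpace ℝ (Fin n)} (hx : x ∈ Ω)
      (ht : t + h ∈ Ioo 0 T) :
      HasDerivAt (fun s => u (s + h) x) (deriv (fun s => u s x) (t + h)) t :=
    (hu.diff_t (t + h) ht x hx).hasDerivAt.comp_add_const t h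
  have hincr (h S : ℝ) (hh : 0 ≤ h) (hS0 : 0 ≤ S) (hS : S + h < T) (x) (hx : x ∈ closure Ω) :
      |u (S + h) x - u S x| ≤ K₁ * h := by
    have hST (t) (ht : t ∈ Ioc 0 S) : t ∈ Ioo 0 T := ⟨ht.1, by linarith [ht.2]⟩
    have hSTh (t) (ht : t ∈ Ioc 0 S) : t + h ∈ Ioo 0 T :=
      ⟨by linarith [ht.1], by linarith [ht.2]⟩
    have hhT : h ∈ Ico 0 T := ⟨hh, by linarith⟩
    have hKh : 0 ≤ K₁ * h := mul_nonneg hK0 hh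
    have h1 : u (S + h) x ≤ u S x + K₁ * h := by
      refine isoDiffusion_comparison (u := fun t x => u (t + h) x)
        (v := fun t x => u t x + K₁ * h) hΩo hΩbd hpd hp1' hε.1 hF'
        (hshift_cont hh hS) ((hucont (by linarith)).add continuousOn_const)
        (fun t ht x hx => (hshift_deriv hx (hSTh t ht)).differentiableAt)
        (fun t ht x hx => (hu.diff_t t (hST t ht) x hx).add_const _)
        (fun t ht => hu.smooth_x _ (hSTh t ht))
        (fun t ht x hx => (hu.smooth_x t (hST t ht) x hx).add contDiffAt_const)
        (fun t ht x hx => ?_) (fun t ht x hx => ?_) (fun x hx => ?_)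
        (fun t ht x hx => ?_) S ⟨hS0, le_rfl⟩ x hx
      · rw [(hshift_deriv hx (hSTh t ht)).deriv]
        exact (heqn _ (hSTh t ht) x hx).le
      · rw [deriv_add_const, isoDiffusion_add_const, gradv_add_const, heqn t (hST t ht) x hx]
        gcongr
        exact hF' x hx _ _ _ (le_add_of_nonneg_right hKh)
      · simpa [hu.init x hx] using hupper h hhT x hx
      · rw [hbdry _ ⟨(hSTh t ht).1.le, (hSTh t ht).2⟩ x hx,
          hbdry t ⟨(hST t ht).1.le, (hST t ht).2⟩ x hx]
        exact le_add_of_nonneg_right hKh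
    have h2 : u S x + -(K₁ * h) ≤ u (S + h) x := by
      refine isoDiffusion_comparison (u := fun t x => u t x + -(K₁ * h))
        (v := fun t x => u (t + h) x) hΩo hΩbd hpd hp1' hε.1 hF'
        ((hucont (by linarith)).add continuousOn_const) (hshift_cont hh hS)
        (fun t ht x hx => (hu.diff_t t (hST t ht) x hx).add_const _)
        (fun t ht x hx => (hshift_deriv hx (hSTh t ht)).differentiableAt)
        (fun t ht x hx => (hu.smooth_x t (hST t ht) x hx).add contDiffAt_const)
        (fun t ht => hu.smooth_x _ (hSTh t ht))
        (fun t ht x hx => ?_) (fun t ht x hx => ?_) (fun x hx => ?_)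
        (fun t ht x hx => ?_) S ⟨hS0, le_rfl⟩ x hx
      · rw [deriv_add_const, isoDiffusion_add_const, gradv_add_const, heqn t (hST t ht) x hx]
        gcongr
        exact hF' x hx _ _ _ (by linarith)
      · rw [(hshift_deriv hx (hSTh t ht)).deriv]
        exact (heqn _ (hSTh t ht) x hx).ge
      · simpa [hu.init x hx] using hlower h hhT x hx
      · rw [hbdry _ ⟨(hSTh t ht).1.le, (hSTh t ht).2⟩ x hx,
          hbdry t ⟨(hST t ht).1.le, (hST t ht).2⟩ x hx]
        linarith
    exact abs_le.mpr ⟨by linarith, by linarith⟩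
  intro t ht x hx
  rw [← Real.norm_eq_abs]
  refine norm_deriv_le_of_lip' hK0 ?_
  filter_upwards [Ioo_mem_nhds ht.1 ht.2] with s hs
  rw [Real.norm_eq_abs, Real.norm_eq_abs]
  rcases le_total t s with hts | hst
  · have h := hincr (s - t) t (sub_nonneg.mpr hts) ht.1.le (by linarith [hs.2]) x
      (subset_closure hx)
    rwa [add_sub_cancel, ← abs_of_nonneg (sub_nonneg.mpr hts)] at h
  · have h := hincr (t - s) s (sub_nonneg.mpr hst) hs.1.le (by linarith [ht.2]) x
      (subset_closure hx)
    rwa [add_sub_cancel, ← abs_of_nonneg (sub_nonneg.mpr hst), abs_sub_comm,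
      abs_sub_comm t s] at h
end
end

section
/- Let u_ε be a classical solution of the regularized isotropic problem with ε ∈ (0,ε₀], satisfying |u_ε| ≤ M on Q̄_T, and suppose F satisfies the monotonicity condition F(x,u,z) ≤ F(x,v,z) whenever u ≥ v. Then in the closed prism P̄ = {(t,τ,x) : t ∈ [0,T], τ ∈ [0,T], x ∈ Ω̄, t ≥ τ} one has u_ε(t,x) − u_ε(τ,x) ≤ K₁(t−τ), where K₁ is the constant defined in the context. -/
open Set Filter MeasureTheory Metric

noncomputable section

/-- Second-order necessary condition for a local maximum. -/
theorem IsLocalMax.fderiv_fderiv_nonpos_s8 {E : Type*} [NormedAddCommGroup E] [NormedSpace ℝ E]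
    {w : E → ℝ} {x : E} (hw : ContDiffAt ℝ 2 w x) (hmax : IsLocalMax w x) (v : E) :
    fderiv ℝ (fderiv ℝ w) x v v ≤ 0 := by
  by_contra! hpos
  set φ : ℝ → ℝ := fun s => w (x + s • v) with hφ
  have hline : ∀ s : ℝ, HasDerivAt (fun s : ℝ => x + s • v) v s := fun s => by
    simpa only [id, one_smul] using ((hasDerivAt_id s).smul_const v).const_add x
  have hcont : Tendsto (fun s : ℝ => x + s • v) (nhds 0) (nhds x) := by
    simpa using (hline 0).continuousAt.tendsto
  have hdiff : ∀ᶠ y in nhds x, DifferentiableAt ℝ w y :=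
    (hw.eventually (by simp)).mono fun y hy => hy.differentiableAt (by simp)
  have hderiv : deriv φ =ᶠ[nhds 0] fun s => fderiv ℝ w (x + s • v) v := by
    filter_upwards [hcont.eventually hdiff] with s hs
    exact (hs.hasFDerivAt.comp_hasDerivAt s (hline s)).deriv
  have hfd : DifferentiableAt ℝ (fderiv ℝ w) x :=
    (hw.fderiv_right (m := 1) (by norm_num)).differentiableAt (by simp)
  have hfd' : HasFDerivAt (fderiv ℝ w) (fderiv ℝ (fderiv ℝ w) x) (x + (0 : ℝ) • v) := by
    simpa using hfd.hasFDerivAt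
  have hsecond : deriv (deriv φ) 0 = fderiv ℝ (fderiv ℝ w) x v v := by
    rw [hderiv.deriv_eq]
    have h : HasDerivAt (fun s : ℝ => fderiv ℝ w (x + s • v)) (fderiv ℝ (fderiv ℝ w) x v) 0 :=
      hfd'.comp_hasDerivAt (f := fun s : ℝ => x + s • v) 0 (hline 0)
    exact ((ContinuousLinearMap.apply ℝ ℝ v).hasFDerivAt.comp_hasDerivAt 0 h).deriv
  have hφmax : IsLocalMax φ 0 := by
    have := hcont.eventually hmax
    filter_upwards [this] with s hs
    simpa [hφ] using hs
  have hφcont : ContinuousAt φ 0 := by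
    have : ContinuousAt w (x + (0 : ℝ) • v) := by simpa using hw.continuousAt
    exact ContinuousAt.comp (f := fun s : ℝ => x + s • v) this (hline 0).continuousAt
  have hφmin : IsLocalMin φ 0 :=
    isLocalMin_of_deriv_deriv_pos (hsecond ▸ hpos) hφmax.deriv_eq_zero hφcont
  have hconst : φ =ᶠ[nhds 0] fun _ => φ 0 := by
    filter_upwards [hφmax, hφmin] with s h₁ h₂
    exact le_antisymm h₁ h₂
  have hzero : deriv (deriv φ) 0 = 0 := by
    rw [hconst.deriv.deriv_eq]
    simp
  rw [← hsecond, hzero] at hpos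
  exact hpos.false

section NegativeForm

variable {n : ℕ}
  (B : EuclideanSpace ℝ (Fin n) →L[ℝ] EuclideanSpace ℝ (Fin n) →L[ℝ] ℝ)
  (z : EuclideanSpace ℝ (Fin n))

theorem bilin_apply_self_eq_sum :
    B z z = ∑ i, ∑ j, z i * z j *
      B (EuclideanSpace.single i 1) (EuclideanSpace.single j 1) := by
  have hz : z = ∑ i, z i • EuclideanSpace.single i (1 : ℝ) := by
    have := (EuclideanSpace.basisFun (Fin n) ℝ).sum_repr z
    simpa using this.symm
  conv_lhs => rw [hz]
  simp only [map_sum, map_smul, sum_apply, smul_apply,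
    smul_eq_mul, Finset.mul_sum]
  rw [Finset.sum_comm]
  exact Finset.sum_congr rfl fun i _ => Finset.sum_congr rfl fun j _ => by ring

/-- A negative semidefinite form satisfies `|z|² tr B ≤ B(z, z)`. -/
theorem norm_sq_mul_trace_le (hB : ∀ v, B v v ≤ 0) :
    ‖z‖ ^ 2 * ∑ i, B (EuclideanSpace.single i 1) (EuclideanSpace.single i 1) ≤ B z z := by
  set H : Fin n → Fin n → ℝ :=
    fun i j => B (EuclideanSpace.single i 1) (EuclideanSpace.single j 1) with hH
  have hpair : ∀ i j, z j * z j * H i i + z i * z i * H j j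
      - z i * z j * H i j - z j * z i * H j i ≤ 0 := fun i j => by
    have := hB (z j • EuclideanSpace.single i 1 - z i • EuclideanSpace.single j 1)
    simp only [map_sub, map_smul, sub_apply, smul_apply,
      smul_eq_mul] at this
    simp only [hH]
    linarith
  have hsum := Finset.sum_nonpos fun i (_ : i ∈ Finset.univ) =>
    Finset.sum_nonpos fun j (_ : j ∈ Finset.univ) => hpair i j
  simp only [Finset.sum_sub_distrib, Finset.sum_add_distrib] at hsum
  have h₁ : ∑ i, ∑ j, z j * z j * H i i = ‖z‖ ^ 2 * ∑ i, H i i := by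
    rw [EuclideanSpace.real_norm_sq_eq, Finset.sum_mul_sum, Finset.sum_comm]
    simp only [sq]
  have h₂ : ∑ i, ∑ j, z i * z i * H j j = ‖z‖ ^ 2 * ∑ i, H i i := by
    rw [← h₁, Finset.sum_comm]
  have h₃ : ∑ i, ∑ j, z j * z i * H j i = ∑ i, ∑ j, z i * z j * H i j := Finset.sum_comm
  rw [h₁, h₂, h₃, ← bilin_apply_self_eq_sum B z] at hsum
  linarith

theorem trace_add_div_mul_nonpos (hB : ∀ v, B v v ≤ 0) {N q : ℝ} (hN : ‖z‖ ^ 2 < N)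
    (hq : -1 < q) :
    ∑ i, B (EuclideanSpace.single i 1) (EuclideanSpace.single i 1) + q / N * B z z ≤ 0 := by
  set tr := ∑ i, B (EuclideanSpace.single i 1) (EuclideanSpace.single i 1)
  have htr : tr ≤ 0 := Finset.sum_nonpos fun i _ => hB _
  have hcs : ‖z‖ ^ 2 * tr ≤ B z z := norm_sq_mul_trace_le B z hB
  have hz := hB z
  have hN0 : 0 < N := (sq_nonneg _).trans_lt hN
  rcases le_total 0 q with h | h
  · exact add_nonpos htr (mul_nonpos_of_nonneg_of_nonpos (by positivity) hz)
  · have hNz : N * tr ≤ B z z := (mul_le_mul_of_nonpos_right hN.le htr).trans hcs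
    have h₁ : q / N * B z z ≤ q / N * (N * tr) :=
      mul_le_mul_of_nonpos_left hNz (div_nonpos_of_nonpos_of_nonneg h hN0.le)
    have h₂ : q / N * (N * tr) = q * tr := by field_simp
    nlinarith

end NegativeForm

section Flux

variable {n : ℕ} {f g p : EuclideanSpace ℝ (Fin n) → ℝ} {x : EuclideanSpace ℝ (Fin n)} {ε : ℝ}

/-- The divergence of the regularized flux, expanded in terms of the Hessian. -/
theorem sum_pd_flux (hf : ContDiffAt ℝ 2 f x) (hp : DifferentiableAt ℝ p x) (hε : 0 < ε) :
    ∑ i, pd (fun y => (‖gradv f y‖ ^ 2 + ε) ^ (p y / 2) * pd f i y) i x =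
      (‖gradv f x‖ ^ 2 + ε) ^ (p x / 2) *
        (∑ i, fderiv ℝ (fderiv ℝ f) x (EuclideanSpace.single i 1) (EuclideanSpace.single i 1)
          + p x / (‖gradv f x‖ ^ 2 + ε) * fderiv ℝ (fderiv ℝ f) x (gradv f x) (gradv f x)
          + Real.log (‖gradv f x‖ ^ 2 + ε) / 2 * ∑ i, pd p i x * gradv f x i) := by
  have hfd : HasFDerivAt (fderiv ℝ f) (fderiv ℝ (fderiv ℝ f) x) x :=
    ((hf.fderiv_right (m := 1) (by norm_num)).differentiableAt (by simp)).hasFDerivAt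
  have hpd : ∀ j, HasFDerivAt (pd f j)
      ((fderiv ℝ (fderiv ℝ f) x).flip (EuclideanSpace.single j 1)) x := fun j => by
    refine (hfd.clm_apply (hasFDerivAt_const (EuclideanSpace.single j (1 : ℝ)) x)).congr_fderiv ?_
    ext v
    simp
  have hnorm : ∀ y, ‖gradv f y‖ ^ 2 + ε = ∑ j, pd f j y ^ 2 + ε := fun y => by
    rw [EuclideanSpace.real_norm_sq_eq]
    rfl
  set N := ‖gradv f x‖ ^ 2 + ε with hN
  have hN0 : 0 < N := by positivity
  have hNd : HasFDerivAt (fun y => ‖gradv f y‖ ^ 2 + ε)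
      (∑ j, (2 * pd f j x) • (fderiv ℝ (fderiv ℝ f) x).flip (EuclideanSpace.single j 1)) x := by
    simp only [hnorm]
    refine (HasFDerivAt.fun_sum fun j _ => ?_).add_const ε
    simpa using (hpd j).pow 2
  have hflux : ∀ i, pd (fun y => (‖gradv f y‖ ^ 2 + ε) ^ (p y / 2) * pd f i y) i x =
      N ^ (p x / 2) * (fderiv ℝ (fderiv ℝ f) x (EuclideanSpace.single i 1)
          (EuclideanSpace.single i 1)
        + p x / N * ∑ j, pd f i x * pd f j x * fderiv ℝ (fderiv ℝ f) x
          (EuclideanSpace.single i 1) (EuclideanSpace.single j 1)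
        + Real.log N / 2 * (pd p i x * pd f i x)) := fun i => by
    have h := (hNd.rpow (hp.hasFDerivAt.mul_const (2⁻¹ : ℝ)) hN0).mul (hpd i)
    simp only [← div_eq_mul_inv] at h
    have hsum : ∑ j, 2 * pd f j x * fderiv ℝ (fderiv ℝ f) x
          (EuclideanSpace.single i 1) (EuclideanSpace.single j 1) * pd f i x
        = 2 * ∑ j, pd f i x * pd f j x * fderiv ℝ (fderiv ℝ f) x
          (EuclideanSpace.single i 1) (EuclideanSpace.single j 1) := by
      rw [Finset.mul_sum]
      exact Finset.sum_congr rfl fun j _ => by ring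
    rw [pd]
    refine (congrArg (fun L => L (EuclideanSpace.single i 1)) h.fderiv).trans ?_
    simp only [← hN, add_apply, smul_apply,
      sum_apply, ContinuousLinearMap.flip_apply, smul_eq_mul,
      Real.rpow_sub_one hN0.ne']
    rw [← Finset.sum_mul] at hsum
    have hp' : fderiv ℝ p x (EuclideanSpace.single i 1) = pd p i x := rfl
    rw [hp']
    field_simp
    linear_combination (p x) * hsum
  rw [Finset.sum_congr rfl fun i _ => hflux i, ← Finset.mul_sum, Finset.sum_add_distrib,
    Finset.sum_add_distrib, ← Finset.mul_sum, ← Finset.mul_sum,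
    bilin_apply_self_eq_sum (fderiv ℝ (fderiv ℝ f) x) (gradv f x)]
  rfl

/-- Degenerate ellipticity: touching at a spatial maximum of `f - g` orders the divergences. -/
theorem sum_pd_flux_le_of_isLocalMax (hf : ContDiffAt ℝ 2 f x) (hg : ContDiffAt ℝ 2 g x)
    (hp : DifferentiableAt ℝ p x) (hp1 : -1 < p x) (hε : 0 < ε)
    (hmax : IsLocalMax (fun y => f y - g y) x) :
    gradv f x = gradv g x ∧
      ∑ i, pd (fun y => (‖gradv f y‖ ^ 2 + ε) ^ (p y / 2) * pd f i y) i x ≤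
        ∑ i, pd (fun y => (‖gradv g y‖ ^ 2 + ε) ^ (p y / 2) * pd g i y) i x := by
  have hfd1 := hf.differentiableAt (by simp)
  have hgd1 := hg.differentiableAt (by simp)
  have hfderiv : fderiv ℝ f x = fderiv ℝ g x := by
    have := hmax.fderiv_eq_zero
    rw [fderiv_fun_sub hfd1 hgd1] at this
    exact sub_eq_zero.mp this
  have hgrad : gradv f x = gradv g x := by simp only [gradv, pd, hfderiv]
  refine ⟨hgrad, ?_⟩
  have hfd2 := (hf.fderiv_right (m := 1) (by norm_num)).differentiableAt (by simp)
  have hgd2 := (hg.fderiv_right (m := 1) (by norm_num)).differentiableAt (by simp)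
  have hev : fderiv ℝ (fun y => f y - g y) =ᶠ[nhds x] fun y => fderiv ℝ f y - fderiv ℝ g y := by
    filter_upwards [hf.eventually (by simp), hg.eventually (by simp)] with y h₁ h₂
    exact fderiv_fun_sub (h₁.differentiableAt (by simp)) (h₂.differentiableAt (by simp))
  have hhess : fderiv ℝ (fderiv ℝ fun y => f y - g y) x =
      fderiv ℝ (fderiv ℝ f) x - fderiv ℝ (fderiv ℝ g) x := by
    rw [hev.fderiv_eq, fderiv_fun_sub hfd2 hgd2]
  have hneg := IsLocalMax.fderiv_fderiv_nonpos_s8 (hf.sub hg) hmax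
  rw [hhess] at hneg
  have hN : ‖gradv g x‖ ^ 2 < ‖gradv g x‖ ^ 2 + ε := by linarith
  have hmain := trace_add_div_mul_nonpos _ (gradv g x) hneg hN hp1
  simp only [sub_apply, Finset.sum_sub_distrib] at hmain
  rw [sum_pd_flux hf hp hε, sum_pd_flux hg hp hε, hgrad]
  refine mul_le_mul_of_nonneg_left ?_ (by positivity)
  linarith

end Flux

/-- Parabolic maximum principle in abstract form: a function which is nonpositive on the parabolic
boundary and has nonpositive time derivative at every positive spatial maximum is nonpositive. -/
theorem nonpos_of_deriv_nonpos_at_max {X : Type*} [TopologicalSpace X] {Ω : Set X}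
    (hΩ : IsOpen Ω) (hK : IsCompact (closure Ω)) {S : ℝ} {w : ℝ → X → ℝ}
    (hw : ContinuousOn (fun q : ℝ × X => w q.1 q.2) (Icc 0 S ×ˢ closure Ω))
    (hinit : ∀ x ∈ closure Ω, w 0 x ≤ 0)
    (hbdry : ∀ t ∈ Icc 0 S, ∀ x ∈ frontier Ω, w t x ≤ 0)
    (hmax : ∀ t ∈ Ioc 0 S, ∀ x ∈ Ω, 0 < w t x → IsLocalMax (w t) x →
      ∃ d ≤ 0, HasDerivAt (fun s => w s x) d t) :
    ∀ t ∈ Icc 0 S, ∀ x ∈ closure Ω, w t x ≤ 0 := by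
  intro t₁ ht₁ x₁ hx₁
  by_contra! hpos
  have ht₁0 : 0 ≤ t₁ := ht₁.1
  obtain ⟨δ, hδ, hδw⟩ : ∃ δ > 0, δ * t₁ < w t₁ x₁ := by
    refine ⟨w t₁ x₁ / (t₁ + 1), by positivity, ?_⟩
    rw [div_mul_eq_mul_div, div_lt_iff₀ (by positivity)]
    nlinarith
  obtain ⟨⟨t, x⟩, ⟨ht, hx⟩, hm⟩ := (isCompact_Icc.prod hK).exists_isMaxOn ⟨(t₁, x₁), ht₁, hx₁⟩
    (hw.sub (f := fun q : ℝ × X => w q.1 q.2) (g := fun q => δ * q.1) (by fun_prop))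
  have hle : ∀ s ∈ Icc 0 S, ∀ y ∈ closure Ω, w s y - δ * s ≤ w t x - δ * t :=
    fun s hs y hy => hm (show (s, y) ∈ Icc 0 S ×ˢ closure Ω from ⟨hs, hy⟩)
  simp only at ht hx
  have hδt : 0 ≤ δ * t := mul_nonneg hδ.le ht.1
  have hwpos : 0 < w t x := by linarith [hle t₁ ht₁ x₁ hx₁]
  have hxΩ : x ∈ Ω := by
    by_contra hxn
    exact hwpos.not_ge (hbdry t ht x (hΩ.frontier_eq ▸ ⟨hx, hxn⟩))
  have ht0 : 0 < t := ht.1.lt_of_ne fun h => by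
    subst h
    exact hwpos.not_ge (hinit x hx)
  obtain ⟨d, hd, hder⟩ := hmax t ⟨ht0, ht.2⟩ x hxΩ hwpos <| by
    filter_upwards [hΩ.mem_nhds hxΩ] with y hy
    linarith [hle t ht y (subset_closure hy)]
  have hder' : HasDerivAt (fun s => w s x - δ * s) (d - δ) t := by
    simpa only [id, mul_one] using hder.fun_sub ((hasDerivAt_id t).const_mul δ)
  have hslope := hasDerivAt_iff_tendsto_slope_left_right.mp hder' |>.1
  have : 0 ≤ d - δ := by
    refine ge_of_tendsto hslope ?_
    filter_upwards [Ioo_mem_nhdsLT ht0] with s hs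
    rw [slope_def_field]
    exact div_nonneg_of_nonpos
      (by linarith [hle s ⟨hs.1.le, hs.2.le.trans ht.2⟩ x hx]) (by linarith [hs.2])
  linarith

theorem stmt8
    (n : ℕ) (hn : 0 < n)
    (Ω : Set (EuclideanSpace ℝ (Fin n)))
    (hΩo : IsOpen Ω) (hΩconn : IsConnected Ω)
    (hΩbd : Bornology.IsBounded Ω) (hΩsph : ExteriorSphereCond Ω)
    (T : ℝ) (hT : 0 < T)
    (γ : ℝ) (hγ : γ ∈ Ioo (0:ℝ) 1)
    (p : EuclideanSpace ℝ (Fin n) → ℝ)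
    (hp : C1HolderOn γ (closure Ω) p)
    (hp1 : ∀ x ∈ closure Ω, -1 < p x)
    (ε₀ : ℝ) (hε₀ : 0 < ε₀)
    (F : EuclideanSpace ℝ (Fin n) → ℝ → EuclideanSpace ℝ (Fin n) → ℝ)
    (hF : ContinuousOn
      (fun q : EuclideanSpace ℝ (Fin n) × ℝ × EuclideanSpace ℝ (Fin n) => F q.1 q.2.1 q.2.2)
      (closure Ω ×ˢ (univ : Set (ℝ × EuclideanSpace ℝ (Fin n)))))
    (hFmono : ∀ x ∈ closure Ω, ∀ v w : ℝ, ∀ z : EuclideanSpace ℝ (Fin n),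
      w ≤ v → F x v z ≤ F x w z)
    (ψ u₀ : EuclideanSpace ℝ (Fin n) → ℝ)
    (U : Set (EuclideanSpace ℝ (Fin n))) (hU : IsOpen U) (hUΩ : closure Ω ⊆ U)
    (hu₀ : ContDiffOn ℝ 2 u₀ U)
    (hu₀ψ : ∀ x ∈ frontier Ω, u₀ x = ψ x)
    (M : ℝ) (hM : 0 < M)
    (ε : ℝ) (hε : ε ∈ Ioc (0:ℝ) ε₀)
    (u : ℝ → EuclideanSpace ℝ (Fin n) → ℝ)
    (hu : IsClassicalSolIso Ω T p F ψ u₀ ε u)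
    (hub : ∀ t ∈ Icc 0 T, ∀ x ∈ closure Ω, |u t x| ≤ M)
    (A B K₁ : ℝ)
    (hA : IsLUB {a : ℝ | ∃ ε' ∈ Icc (0:ℝ) ε₀, ∃ x ∈ closure Ω,
      a = |∑ i, pd (fun y => (‖gradv u₀ y‖ ^ 2 + ε') ^ (p y / 2) * pd u₀ i y) i x|} A)
    (hB : IsLUB {a : ℝ | ∃ x ∈ closure Ω, ∃ v ∈ Icc (-M) M,
      a = |F x v (gradv u₀ x)|} B)
    (hK₁ : K₁ = A + B)
    :
    ∀ t ∈ Icc 0 T, ∀ τ ∈ Icc 0 T, τ ≤ t → ∀ x ∈ closure Ω,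
      u t x - u τ x ≤ K₁ * (t - τ) := by
  have hε0 : 0 < ε := hε.1
  have hK : IsCompact (closure Ω) := hΩbd.isCompact_closure
  have hpd : ∀ x ∈ Ω, DifferentiableAt ℝ p x := fun x hx =>
    (hp.1.differentiableOn (by simp)).differentiableAt
      (mem_of_superset (hΩo.mem_nhds hx) subset_closure)
  have hu₀2 : ∀ x ∈ Ω, ContDiffAt ℝ 2 u₀ x := fun x hx =>
    hu₀.contDiffAt (hU.mem_nhds (hUΩ (subset_closure hx)))
  have hu₀M : ∀ x ∈ closure Ω, |u₀ x| ≤ M := fun x hx =>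
    hu.init x hx ▸ hub 0 ⟨le_rfl, hT.le⟩ x hx
  have hK₁0 : 0 ≤ K₁ := by
    obtain ⟨x, hx⟩ := hΩconn.nonempty
    have hxc := subset_closure hx
    have hA0 := hA.1 ⟨0, ⟨le_rfl, hε₀.le⟩, x, hxc, rfl⟩
    have hB0 := hB.1 ⟨x, hxc, 0, ⟨by linarith, hM.le⟩, rfl⟩
    rw [hK₁]
    exact add_nonneg ((abs_nonneg _).trans hA0) ((abs_nonneg _).trans hB0)
  have hbdry : ∀ t ∈ Ico 0 T, ∀ x ∈ frontier Ω, u t x = ψ x := fun t ht x hx => by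
    rcases ht.1.eq_or_lt with rfl | h
    · rw [hu.init x (frontier_subset_closure hx), hu₀ψ x hx]
    · exact hu.bdry t ⟨h, ht.2⟩ x hx
  have hstart : ∀ t ∈ Ico 0 T, ∀ x ∈ closure Ω, u t x - u₀ x - K₁ * t ≤ 0 := by
    intro S hS
    refine nonpos_of_deriv_nonpos_at_max hΩo hK
      (w := fun t x => u t x - u₀ x - K₁ * t) ?_ ?_ ?_ ?_ S ⟨hS.1, le_rfl⟩
    · refine ((hu.cont.mono (prod_mono_left (Icc_subset_Icc_right hS.2.le))).sub ?_).sub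
        (by fun_prop)
      exact (hu₀.continuousOn.mono hUΩ).comp continuousOn_snd fun q hq => hq.2
    · intro x hx
      simp [hu.init x hx]
    · intro t ht x hx
      have h := mul_nonneg hK₁0 ht.1
      simp only [hbdry t ⟨ht.1, ht.2.trans_lt hS.2⟩ x hx, hu₀ψ x hx]
      linarith
    · intro t ht x hx hpos hmax
      have htT : t ∈ Ioo 0 T := ⟨ht.1, ht.2.trans_lt hS.2⟩
      have hxc := subset_closure hx
      have hmax' : IsLocalMax (fun y => u t y - u₀ y) x :=
        hmax.mono fun y hy => by simpa using hy
      obtain ⟨hgrad, hdiv⟩ := sum_pd_flux_le_of_isLocalMax (hu.smooth_x t htT x hx) (hu₀2 x hx)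
        (hpd x hx) (hp1 x hxc) hε0 hmax'
      refine ⟨_, ?_, ((hu.diff_t t htT x hx).hasDerivAt.sub_const (u₀ x)).sub
        ((hasDerivAt_id t).const_mul K₁)⟩
      have hA' := hA.1 ⟨ε, ⟨hε0.le, hε.2⟩, x, hxc, rfl⟩
      have hB' := hB.1 ⟨x, hxc, u₀ x, abs_le.mp (hu₀M x hxc), rfl⟩
      have hle : u₀ x ≤ u t x := by
        have h := mul_nonneg hK₁0 ht.1.le
        linarith
      have hFle := hFmono x hxc (u t x) (u₀ x) (gradv u₀ x) hle
      rw [hu.eqn t htT x hx, hgrad, hK₁]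
      linarith [le_abs_self (F x (u₀ x) (gradv u₀ x)), (le_abs_self _).trans hA']
  have hshift : ∀ τ t : ℝ, 0 ≤ τ → τ < t → t < T → ∀ x ∈ closure Ω,
      u t x - u τ x ≤ K₁ * (t - τ) := by
    intro τ t hτ hτt htT
    obtain ⟨h, hh, rfl⟩ : ∃ h > 0, t = τ + h := ⟨t - τ, by linarith, by ring⟩
    have hKh := mul_nonneg hK₁0 hh.le
    have key : ∀ s ∈ Icc 0 τ, ∀ x ∈ closure Ω, u (s + h) x - u s x - K₁ * h ≤ 0 := by
      refine nonpos_of_deriv_nonpos_at_max hΩo hK ?_ ?_ ?_ ?_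
      · refine ContinuousOn.sub (ContinuousOn.sub ?_ ?_) continuousOn_const
        · exact hu.cont.comp (f := fun q : ℝ × EuclideanSpace ℝ (Fin n) => (q.1 + h, q.2))
            (by fun_prop) fun q hq => ⟨⟨by linarith [hq.1.1], by linarith [hq.1.2]⟩, hq.2⟩
        · exact hu.cont.mono (prod_mono_left (Icc_subset_Icc_right (by linarith)))
      · intro x hx
        rw [zero_add, hu.init x hx]
        exact hstart h ⟨hh.le, by linarith⟩ x hx
      · intro s hs x hx
        rw [hbdry s ⟨hs.1, by linarith [hs.2]⟩ x hx,
          hbdry (s + h) ⟨by linarith [hs.1], by linarith [hs.2]⟩ x hx]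
        linarith
      · intro s hs x hx hpos hmax
        have hsT : s ∈ Ioo 0 T := ⟨hs.1, by linarith [hs.2]⟩
        have hshT : s + h ∈ Ioo 0 T := ⟨by linarith [hs.1], by linarith [hs.2]⟩
        have hxc := subset_closure hx
        have hmax' : IsLocalMax (fun y => u (s + h) y - u s y) x :=
          hmax.mono fun y hy => by simpa using hy
        obtain ⟨hgrad, hdiv⟩ := sum_pd_flux_le_of_isLocalMax (hu.smooth_x _ hshT x hx)
          (hu.smooth_x s hsT x hx) (hpd x hx) (hp1 x hxc) hε0 hmax'
        refine ⟨_, ?_, (((hu.diff_t _ hshT x hx).hasDerivAt.comp_add_const s h).sub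
          (hu.diff_t s hsT x hx).hasDerivAt).sub_const (K₁ * h)⟩
        have hFle := hFmono x hxc (u (s + h) x) (u s x) (gradv (u s) x) (by linarith)
        rw [hu.eqn _ hshT x hx, hu.eqn s hsT x hx, hgrad]
        linarith
    intro x hx
    have := key τ ⟨hτ, le_rfl⟩ x hx
    rw [add_sub_cancel_left]
    linarith
  intro t ht τ hτ hτt x hx
  rcases hτt.eq_or_lt with rfl | hlt
  · simp
  rcases ht.2.lt_or_eq with htT | rfl
  · exact hshift τ t hτ.1 hlt htT x hx
  · have hcont : ContinuousOn (fun s => u s x) (Icc 0 t) :=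
      hu.cont.comp (f := fun s => (s, x)) (by fun_prop) fun s hs => ⟨hs, hx⟩
    have hlim : Tendsto (fun s => u s x) (nhdsWithin t (Ioo τ t)) (nhds (u t x)) :=
      (hcont t ht).mono_left (nhdsWithin_mono t fun s hs => ⟨hτ.1.trans hs.1.le, hs.2.le⟩)
    have : (nhdsWithin t (Ioo τ t)).NeBot := right_nhdsWithin_Ioo_neBot hlt
    have hrhs : Tendsto (fun s => K₁ * (s - τ)) (nhdsWithin t (Ioo τ t))
        (nhds (K₁ * (t - τ))) :=
      (Continuous.tendsto (by fun_prop) t).mono_left nhdsWithin_le_nhds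
    refine le_of_tendsto_of_tendsto (hlim.sub_const (u τ x)) hrhs ?_
    filter_upwards [self_mem_nhdsWithin] with s hs
    exact hshift τ s hτ.1 hs.1 hs.2 x hx
end
end
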